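/- arXiv:2409.02623 — 4 statements merged into one kernel-verified Lean document; each statement's English description precedes it below -/
import Mathlib

section
/- Let α, β ∈ [-1/2, 1/2], set ρ_α = α/2 + 1/4, ρ_β = β/2 + 1/4 and q = max(α,β), and for n ≥ 1 let P_n^{(α,β),monic} be the monic Jacobi polynomial of degree n. Then for every x ∈ [-1,1], (1-x)^{ρ_α} (1+x)^{ρ_β} |P_n^{(α,β),monic}(x)| ≤ 2^{n+(α+β+1)/2} Γ(n+q+1) Γ(n+α+β+1) / ( √π · (n+(α+β+1)/2)^{q+1/2} · Γ(2n+α+β+1) ). -/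
open MeasureTheory

/-- `P` is the monic Jacobi polynomial of degree `n` with parameters `α, β`. -/
def IsMonicJacobi (α β : ℝ) (n : ℕ) (P : Polynomial ℝ) : Prop :=
  P.Monic ∧ P.natDegree = n ∧
    ∀ k : ℕ, k < n →
      ∫ x in (-1 : ℝ)..1, (1 - x) ^ α * (1 + x) ^ β * P.eval x * x ^ k = 0

section

open Set Filter Topology

lemma sin_ge_sub_cube {x : ℝ} (hx : 0 ≤ x) : x - x ^ 3 / 6 ≤ Real.sin x := by
  have hm : MonotoneOn (fun x : ℝ => Real.sin x - (x - x ^ 3 / 6)) (Ici 0) := by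
    have hd : ∀ x : ℝ, HasDerivAt (fun x : ℝ => Real.sin x - (x - x ^ 3 / 6))
        (Real.cos x - (1 - x ^ 2 / 2)) x := fun x => by
      refine ((Real.hasDerivAt_sin x).sub ((hasDerivAt_id x).sub
        ((hasDerivAt_pow 3 x).div_const 6))).congr_deriv ?_
      simp; ring
    refine monotoneOn_of_deriv_nonneg (convex_Ici 0)
      (fun z _ => (hd z).continuousAt.continuousWithinAt)
      (fun z _ => (hd z).differentiableAt.differentiableWithinAt) ?_
    intro z _
    rw [(hd z).deriv]
    linarith [Real.one_sub_sq_div_two_le_cos (x := z)]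
  have := hm (mem_Ici.2 le_rfl) hx hx
  simp at this
  linarith

lemma cos_le_quartic {x : ℝ} (hx : 0 ≤ x) : Real.cos x ≤ 1 - x ^ 2 / 2 + x ^ 4 / 24 := by
  have hm : MonotoneOn (fun x : ℝ => (1 - x ^ 2 / 2 + x ^ 4 / 24) - Real.cos x) (Ici 0) := by
    have hd : ∀ x : ℝ, HasDerivAt (fun x : ℝ => (1 - x ^ 2 / 2 + x ^ 4 / 24) - Real.cos x)
        (Real.sin x - (x - x ^ 3 / 6)) x := fun x => by
      refine (((((hasDerivAt_pow 2 x).div_const 2).const_sub 1).add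
        ((hasDerivAt_pow 4 x).div_const 24)).sub (Real.hasDerivAt_cos x)).congr_deriv ?_
      simp; ring
    refine monotoneOn_of_deriv_nonneg (convex_Ici 0)
      (fun z _ => (hd z).continuousAt.continuousWithinAt)
      (fun z _ => (hd z).differentiableAt.differentiableWithinAt) ?_
    intro z hz
    rw [interior_Ici] at hz
    rw [(hd z).deriv]
    linarith [sin_ge_sub_cube (le_of_lt hz)]
  have := hm (mem_Ici.2 le_rfl) hx hx
  simp at this
  linarith

lemma cube_mul_cos_le_sin_cube {x : ℝ} (hx : 0 ≤ x) (hx2 : x ≤ Real.pi / 2) :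
    x ^ 3 * Real.cos x ≤ Real.sin x ^ 3 := by
  have h2 : x ≤ 2 := by linarith [Real.pi_lt_four]
  have h1 : 0 ≤ x - x ^ 3 / 6 := by
    have : x - x ^ 3 / 6 = x * (1 - x ^ 2 / 6) := by ring
    rw [this]
    exact mul_nonneg hx (by nlinarith)
  calc x ^ 3 * Real.cos x ≤ x ^ 3 * (1 - x ^ 2 / 2 + x ^ 4 / 24) := by
        gcongr; exact cos_le_quartic hx
    _ ≤ (x - x ^ 3 / 6) ^ 3 := by
        have h3 : (x - x ^ 3 / 6) ^ 3 - x ^ 3 * (1 - x ^ 2 / 2 + x ^ 4 / 24) =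
          x ^ 7 * (9 - x ^ 2) / 216 := by ring
        have : 0 ≤ x ^ 7 * (9 - x ^ 2) / 216 :=
          div_nonneg (mul_nonneg (by positivity) (by nlinarith)) (by norm_num)
        linarith
    _ ≤ _ := by gcongr; exact sin_ge_sub_cube hx

/-- The difference between the half-angle potential and the Bessel potential. -/
noncomputable def potentialGap (κ κ' t : ℝ) : ℝ :=
  κ * (1 / (4 * Real.sin (t / 2) ^ 2) - 1 / t ^ 2) + κ' * (1 / (4 * Real.cos (t / 2) ^ 2))

noncomputable def potentialGapDeriv (κ κ' t : ℝ) : ℝ :=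
  κ * (2 / t ^ 3 - Real.cos (t / 2) / (4 * Real.sin (t / 2) ^ 3)) +
    κ' * (Real.sin (t / 2) / (4 * Real.cos (t / 2) ^ 3))

lemma sin_half_pos {t : ℝ} (ht : t ∈ Ioo 0 Real.pi) : 0 < Real.sin (t / 2) :=
  Real.sin_pos_of_pos_of_lt_pi (by linarith [ht.1]) (by linarith [ht.1, ht.2])

lemma cos_half_pos {t : ℝ} (ht : t ∈ Ioo 0 Real.pi) : 0 < Real.cos (t / 2) :=
  Real.cos_pos_of_mem_Ioo ⟨by linarith [ht.1, ht.2], by linarith [ht.2]⟩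

lemma hasDerivAt_sin_half (t : ℝ) :
    HasDerivAt (fun t => Real.sin (t / 2)) (Real.cos (t / 2) / 2) t :=
  ((hasDerivAt_id' t).div_const 2).sin.congr_deriv (by ring)

lemma hasDerivAt_cos_half (t : ℝ) :
    HasDerivAt (fun t => Real.cos (t / 2)) (-(Real.sin (t / 2) / 2)) t :=
  ((hasDerivAt_id' t).div_const 2).cos.congr_deriv (by ring)

lemma hasDerivAt_potentialGap (κ κ' : ℝ) {t : ℝ} (ht : t ∈ Ioo 0 Real.pi) :
    HasDerivAt (potentialGap κ κ') (potentialGapDeriv κ κ' t) t := by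
  have hs := sin_half_pos ht
  have hc := cos_half_pos ht
  have ht0 := ht.1
  unfold potentialGap potentialGapDeriv
  refine (((((hasDerivAt_const t 1).div (((hasDerivAt_sin_half t).pow 2).const_mul 4)
    (by simp; positivity)).sub
    ((hasDerivAt_const t 1).div (hasDerivAt_pow 2 t) (by positivity))).const_mul κ).add
    (((hasDerivAt_const t 1).div (((hasDerivAt_cos_half t).pow 2).const_mul 4)
    (by simp; positivity)).const_mul κ')).congr_deriv ?_
  simp
  generalize Real.sin (t / 2) = s at *
  generalize Real.cos (t / 2) = c at *
  field_simp
  ring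

lemma potentialGap_nonneg {κ κ' : ℝ} (hκ : 0 ≤ κ) (hκ' : 0 ≤ κ') {t : ℝ}
    (ht : t ∈ Ioo 0 Real.pi) : 0 ≤ potentialGap κ κ' t := by
  have hs := sin_half_pos ht
  have ht0 := ht.1
  refine add_nonneg (mul_nonneg hκ ?_) (mul_nonneg hκ' (by positivity))
  rw [sub_nonneg]
  refine one_div_le_one_div_of_le (by positivity) ?_
  have := (Real.sin_lt (show 0 < t / 2 by linarith)).le
  nlinarith

lemma potentialGapDeriv_nonneg {κ κ' : ℝ} (hκ : 0 ≤ κ) (hκ' : 0 ≤ κ') {t : ℝ}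
    (ht : t ∈ Ioo 0 Real.pi) : 0 ≤ potentialGapDeriv κ κ' t := by
  have hs := sin_half_pos ht
  have hc := cos_half_pos ht
  have ht0 := ht.1
  refine add_nonneg (mul_nonneg hκ ?_) (mul_nonneg hκ' (by positivity))
  rw [sub_nonneg, div_le_div_iff₀ (by positivity) (by positivity)]
  have := cube_mul_cos_le_sin_cube (x := t / 2) (by linarith) (by linarith [ht.2])
  nlinarith

/-- The integrand of `gammaKernel`. -/
noncomputable def gammaKernelIntegrand (p m x s : ℝ) : ℂ :=
  ((Real.exp (-s) * s ^ p : ℝ) : ℂ) * (1 + Complex.I * s * x) ^ (m : ℂ)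

/-- The integral `∫₀^∞ e^{-s} s^p (1 + i s x)^m ds`. -/
noncomputable def gammaKernel (p m x : ℝ) : ℂ := ∫ s in Ioi (0 : ℝ), gammaKernelIntegrand p m x s

lemma one_add_I_re (s x : ℝ) : (1 + Complex.I * s * x).re = 1 := by simp

lemma one_add_I_im (s x : ℝ) : (1 + Complex.I * s * x).im = s * x := by simp

lemma one_add_I_mem_slitPlane (s x : ℝ) : 1 + Complex.I * s * x ∈ Complex.slitPlane :=
  Or.inl (by rw [one_add_I_re]; exact one_pos)

lemma one_add_I_ne_zero (s x : ℝ) : 1 + Complex.I * s * x ≠ 0 :=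
  Complex.slitPlane_ne_zero (one_add_I_mem_slitPlane s x)

lemma one_le_norm_one_add_I (s x : ℝ) : 1 ≤ ‖1 + Complex.I * s * x‖ := by
  have := Complex.re_le_norm (1 + Complex.I * s * x)
  rwa [one_add_I_re] at this

lemma norm_one_add_I_cpow_le {m : ℝ} (hm : m ≤ 0) (s x : ℝ) :
    ‖(1 + Complex.I * s * x) ^ (m : ℂ)‖ ≤ 1 := by
  rw [Complex.norm_cpow_real]
  exact Real.rpow_le_one_of_one_le_of_nonpos (one_le_norm_one_add_I s x) hm

lemma integrableOn_exp_mul_rpow {p : ℝ} (hp : -1 < p) :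
    IntegrableOn (fun s => Real.exp (-s) * s ^ p) (Ioi 0) := by
  have := Real.GammaIntegral_convergent (s := p + 1) (by linarith)
  simpa using this

lemma norm_gammaKernelIntegrand_le {p m : ℝ} (hm : m ≤ 0) (x : ℝ) {s : ℝ} (hs : s ∈ Ioi (0 : ℝ)) :
    ‖gammaKernelIntegrand p m x s‖ ≤ Real.exp (-s) * s ^ p := by
  have hs : 0 < s := hs
  have h0 : 0 ≤ Real.exp (-s) * s ^ p := by positivity
  rw [gammaKernelIntegrand, norm_mul, Complex.norm_real, Real.norm_of_nonneg h0]
  exact mul_le_of_le_one_right h0 (norm_one_add_I_cpow_le hm s x)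

lemma continuousOn_gammaKernelIntegrand (p m x : ℝ) :
    ContinuousOn (gammaKernelIntegrand p m x) (Ioi 0) := by
  unfold gammaKernelIntegrand
  refine ContinuousOn.mul ?_ ?_
  · refine Complex.continuous_ofReal.comp_continuousOn ?_
    refine (by fun_prop : Continuous fun s : ℝ => Real.exp (-s)).continuousOn.mul ?_
    exact fun s hs => (Real.continuousAt_rpow_const s p (Or.inl (ne_of_gt hs))).continuousWithinAt
  · refine Continuous.continuousOn ?_
    exact Continuous.cpow (by fun_prop) continuous_const fun s => one_add_I_mem_slitPlane s x

lemma aestronglyMeasurable_gammaKernelIntegrand (p m x : ℝ) :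
    AEStronglyMeasurable (gammaKernelIntegrand p m x) (volume.restrict (Ioi 0)) :=
  (continuousOn_gammaKernelIntegrand p m x).aestronglyMeasurable measurableSet_Ioi

lemma integrableOn_gammaKernelIntegrand {p m : ℝ} (hp : -1 < p) (hm : m ≤ 0) (x : ℝ) :
    IntegrableOn (gammaKernelIntegrand p m x) (Ioi 0) := by
  refine (integrableOn_exp_mul_rpow hp).mono' (aestronglyMeasurable_gammaKernelIntegrand p m x) ?_
  filter_upwards [ae_restrict_mem measurableSet_Ioi] with s hs
  exact norm_gammaKernelIntegrand_le hm x hs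

lemma norm_gammaKernel_le {p m : ℝ} (hp : -1 < p) (hm : m ≤ 0) (x : ℝ) :
    ‖gammaKernel p m x‖ ≤ Real.Gamma (p + 1) := by
  rw [Real.Gamma_eq_integral (by linarith), add_sub_cancel_right]
  refine norm_integral_le_of_norm_le (integrableOn_exp_mul_rpow hp) ?_
  filter_upwards [ae_restrict_mem measurableSet_Ioi] with s hs
  exact norm_gammaKernelIntegrand_le hm x hs

lemma gammaKernel_zero {p : ℝ} (hp : -1 < p) (m : ℝ) :
    gammaKernel p m 0 = Real.Gamma (p + 1) := by
  rw [Real.Gamma_eq_integral (by linarith), add_sub_cancel_right, ← integral_complex_ofReal]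
  simp [gammaKernel, gammaKernelIntegrand]

lemma gammaKernelIntegrand_succ {s : ℝ} (hs : 0 < s) (p m x : ℝ) :
    gammaKernelIntegrand (p + 1) m x s = s * gammaKernelIntegrand p m x s := by
  simp only [gammaKernelIntegrand, Real.rpow_add_one hs.ne']
  push_cast
  ring

lemma gammaKernelIntegrand_add_one (p m x s : ℝ) :
    gammaKernelIntegrand p (m + 1) x s =
      (1 + Complex.I * s * x) * gammaKernelIntegrand p m x s := by
  simp only [gammaKernelIntegrand]
  push_cast
  rw [Complex.cpow_add _ _ (one_add_I_ne_zero s x), Complex.cpow_one]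
  ring

lemma hasDerivAt_gammaKernel {p m : ℝ} (hp : -1 < p) (hm : m ≤ 0) (x : ℝ) :
    HasDerivAt (gammaKernel p m) (Complex.I * m * gammaKernel (p + 1) (m - 1) x) x := by
  have h := hasDerivAt_integral_of_dominated_loc_of_deriv_le (𝕜 := ℝ)
    (μ := volume.restrict (Ioi (0 : ℝ))) (F := fun x s => gammaKernelIntegrand p m x s)
    (F' := fun x s => Complex.I * m * gammaKernelIntegrand (p + 1) (m - 1) x s)
    (bound := fun s => |m| * (Real.exp (-s) * s ^ (p + 1))) (x₀ := x) (s := univ)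
    univ_mem (Eventually.of_forall fun x => aestronglyMeasurable_gammaKernelIntegrand p m x)
    (integrableOn_gammaKernelIntegrand hp hm x)
    ((aestronglyMeasurable_gammaKernelIntegrand _ _ x).const_mul _) ?_
    ((integrableOn_exp_mul_rpow (by linarith)).const_mul _) ?_
  · refine h.2.congr_deriv ?_
    rw [gammaKernel, ← integral_const_mul]
  · filter_upwards [ae_restrict_mem measurableSet_Ioi] with s hs y _
    rw [norm_mul, norm_mul, Complex.norm_I, one_mul, Complex.norm_real, Real.norm_eq_abs]
    exact mul_le_mul_of_nonneg_left (norm_gammaKernelIntegrand_le (by linarith) y hs)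
      (abs_nonneg m)
  · filter_upwards [ae_restrict_mem measurableSet_Ioi] with s hs y _
    have h1 : HasDerivAt (fun y : ℝ => 1 + Complex.I * s * (y : ℂ)) (Complex.I * s) y := by
      simpa using ((Complex.ofRealCLM.hasDerivAt (x := y)).const_mul (Complex.I * s)).const_add 1
    have h2 := ((Complex.hasStrictDerivAt_cpow_const (c := (m : ℂ))
      (one_add_I_mem_slitPlane s y)).hasDerivAt.comp y h1).const_mul
      ((Real.exp (-s) * s ^ p : ℝ) : ℂ)
    refine h2.congr_deriv ?_
    rw [gammaKernelIntegrand_succ hs]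
    simp only [gammaKernelIntegrand]
    push_cast
    ring

lemma continuous_gammaKernel {p m : ℝ} (hp : -1 < p) (hm : m ≤ 0) :
    Continuous (gammaKernel p m) :=
  continuous_iff_continuousAt.2 fun x => (hasDerivAt_gammaKernel hp hm x).continuousAt

lemma gammaKernel_add_one {p m : ℝ} (hp : -1 < p) (hm : m ≤ 0) (x : ℝ) :
    gammaKernel p (m + 1) x = gammaKernel p m x + Complex.I * x * gammaKernel (p + 1) m x := by
  rw [gammaKernel, gammaKernel, gammaKernel, ← integral_const_mul, ← integral_add
    (integrableOn_gammaKernelIntegrand hp hm x)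
    ((integrableOn_gammaKernelIntegrand (by linarith) hm x).const_mul _)]
  refine setIntegral_congr_fun measurableSet_Ioi fun s hs => ?_
  simp only [gammaKernelIntegrand_add_one, gammaKernelIntegrand_succ hs]
  ring

lemma gammaKernel_parts {p m : ℝ} (hp : -1 < p) (hm : m ≤ 0) (x : ℝ) :
    (p + 1) * gammaKernel p m x - gammaKernel (p + 1) m x +
      Complex.I * m * x * gammaKernel (p + 1) (m - 1) x = 0 := by
  have i1 := (integrableOn_gammaKernelIntegrand hp hm x).const_mul ((p : ℂ) + 1)
  have i2 := integrableOn_gammaKernelIntegrand (p := p + 1) (by linarith) hm x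
  have i3 := (integrableOn_gammaKernelIntegrand (p := p + 1) (m := m - 1) (by linarith)
    (by linarith) x).const_mul (Complex.I * m * x)
  have h := integral_Ioi_of_hasDerivAt_of_tendsto (a := (0 : ℝ)) (m := (0 : ℂ))
    (f := gammaKernelIntegrand (p + 1) m x)
    (f' := fun s => (p + 1) * gammaKernelIntegrand p m x s - gammaKernelIntegrand (p + 1) m x s +
      Complex.I * m * x * gammaKernelIntegrand (p + 1) (m - 1) x s) ?_ ?_ ((i1.sub i2).add i3) ?_
  · have i12 : IntegrableOn (fun s => (p + 1) * gammaKernelIntegrand p m x s -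
        gammaKernelIntegrand (p + 1) m x s) (Ioi 0) := i1.sub i2
    rw [integral_add i12 i3, integral_sub i1 i2, integral_const_mul,
      integral_const_mul] at h
    rw [gammaKernel, gammaKernel, gammaKernel, h]
    simp [gammaKernelIntegrand, Real.zero_rpow (show p + 1 ≠ 0 by linarith)]
  · unfold gammaKernelIntegrand
    refine Continuous.continuousWithinAt ?_
    refine Continuous.mul ?_ (Continuous.cpow (by fun_prop) continuous_const
      fun s => one_add_I_mem_slitPlane s x)
    refine Complex.continuous_ofReal.comp (Continuous.mul (by fun_prop) ?_)
    exact Real.continuous_rpow_const (by linarith)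
  · intro s hs
    have hs0 : 0 < s := hs
    have h1 : HasDerivAt (fun s : ℝ => 1 + Complex.I * (s : ℂ) * x) (Complex.I * x) s := by
      simpa using (((Complex.ofRealCLM.hasDerivAt (x := s)).const_mul
        Complex.I).mul_const (x : ℂ)).const_add 1
    have h2 := (Complex.hasStrictDerivAt_cpow_const (c := (m : ℂ))
      (one_add_I_mem_slitPlane s x)).hasDerivAt.comp s h1
    have h3 := (((hasDerivAt_neg s).exp).mul
      (Real.hasDerivAt_rpow_const (x := s) (p := p + 1) (Or.inl hs0.ne'))).ofReal_comp
    refine (h3.mul h2).congr_deriv ?_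
    have e := gammaKernelIntegrand_succ hs0 p m x
    simp only [gammaKernelIntegrand] at e ⊢
    simp only [add_sub_cancel_right]
    push_cast at e ⊢
    simp
    linear_combination (0 : ℂ) * e
  · have hl : Tendsto (fun s : ℝ => Real.exp (-s) * s ^ (p + 1)) atTop (𝓝 0) := by
      have := tendsto_rpow_mul_exp_neg_mul_atTop_nhds_zero (p + 1) 1 one_pos
      refine this.congr fun s => ?_
      rw [neg_mul, one_mul, mul_comm]
    refine squeeze_zero_norm' ?_ hl
    filter_upwards [eventually_gt_atTop 0] with s hs
    exact norm_gammaKernelIntegrand_le hm x hs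

lemma tendsto_rpow_mul_gammaKernel {p μ : ℝ} (hμ : 0 ≤ μ) (hp : -1 < p - μ) :
    Tendsto (fun x : ℝ => ((x ^ μ : ℝ) : ℂ) * gammaKernel p (-μ) x) atTop
      (𝓝 (Real.Gamma (p - μ + 1) * Complex.I ^ (-μ : ℂ))) := by
  have hG : (Real.Gamma (p - μ + 1) * Complex.I ^ (-μ : ℂ) : ℂ) =
      ∫ s in Ioi (0 : ℝ), ((Real.exp (-s) * s ^ (p - μ) : ℝ) : ℂ) * Complex.I ^ (-μ : ℂ) := by
    rw [integral_mul_const, integral_complex_ofReal, Real.Gamma_eq_integral (by linarith),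
      add_sub_cancel_right]
  have hmul : ∀ {a : ℝ} (_ : 0 < a) (w : ℂ) (_ : w ≠ 0),
      ((a : ℂ) * w) ^ (-μ : ℂ) = ((a ^ (-μ) : ℝ) : ℂ) * w ^ (-μ : ℂ) := by
    intro a ha w hw
    have ha' : (a : ℂ) ≠ 0 := by exact_mod_cast ha.ne'
    rw [Complex.ofReal_cpow ha.le, Complex.cpow_def_of_ne_zero (mul_ne_zero ha' hw),
      Complex.log_ofReal_mul ha hw, add_mul, Complex.exp_add, Complex.cpow_def_of_ne_zero hw,
      Complex.cpow_def_of_ne_zero ha', Complex.ofReal_log ha.le]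
    push_cast
    rfl
  have hInt : ∀ {x s : ℝ}, 0 < x → 0 < s → ((x ^ μ : ℝ) : ℂ) * gammaKernelIntegrand p (-μ) x s =
      ((Real.exp (-s) * s ^ (p - μ) : ℝ) : ℂ) *
        (((s * x)⁻¹ : ℝ) + Complex.I) ^ (-μ : ℂ) := by
    intro x s hx hs
    have h1 : (1 + Complex.I * s * x : ℂ) =
        ((s * x : ℝ) : ℂ) * ((((s * x)⁻¹ : ℝ) : ℂ) + Complex.I) := by
      have : (s : ℂ) ≠ 0 := by exact_mod_cast hs.ne'
      have : (x : ℂ) ≠ 0 := by exact_mod_cast hx.ne'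
      push_cast
      field_simp
    have h2 : (((s * x)⁻¹ : ℝ) : ℂ) + Complex.I ≠ 0 := by
      intro h
      have := congrArg Complex.im h
      simp at this
    rw [gammaKernelIntegrand, h1]
    rw [show (((-μ : ℝ)) : ℂ) = (-μ : ℂ) by push_cast; rfl, hmul (by positivity) _ h2]
    rw [Real.mul_rpow hs.le hx.le, Real.rpow_sub hs, Real.rpow_neg hs.le, Real.rpow_neg hx.le]
    have : ((x ^ μ : ℝ) : ℂ) ≠ 0 := by exact_mod_cast (Real.rpow_pos_of_pos hx μ).ne'
    have : ((s ^ μ : ℝ) : ℂ) ≠ 0 := by exact_mod_cast (Real.rpow_pos_of_pos hs μ).ne'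
    push_cast
    field_simp
  rw [hG]
  have hev : ∀ᶠ x : ℝ in atTop, ((x ^ μ : ℝ) : ℂ) * gammaKernel p (-μ) x =
      ∫ s in Ioi (0 : ℝ), ((x ^ μ : ℝ) : ℂ) * gammaKernelIntegrand p (-μ) x s :=
    Eventually.of_forall fun x => by rw [gammaKernel, integral_const_mul]
  refine Tendsto.congr' (EventuallyEq.symm hev) ?_
  refine tendsto_integral_filter_of_dominated_convergence
    (fun s => Real.exp (-s) * s ^ (p - μ)) ?_ ?_ (integrableOn_exp_mul_rpow hp) ?_
  · exact Eventually.of_forall fun x =>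
      (aestronglyMeasurable_gammaKernelIntegrand p (-μ) x).const_mul _
  · filter_upwards [eventually_gt_atTop 0] with x hx
    filter_upwards [ae_restrict_mem measurableSet_Ioi] with s hs
    have hs : 0 < s := hs
    rw [hInt hx hs, norm_mul, Complex.norm_real, Real.norm_of_nonneg (by positivity)]
    refine mul_le_of_le_one_right (by positivity) ?_
    rw [show (-μ : ℂ) = ((-μ : ℝ) : ℂ) by push_cast; rfl, Complex.norm_cpow_real]
    refine Real.rpow_le_one_of_one_le_of_nonpos ?_ (by linarith)
    have := Complex.abs_im_le_norm ((((s * x)⁻¹ : ℝ) : ℂ) + Complex.I)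
    simpa using this
  · filter_upwards [ae_restrict_mem measurableSet_Ioi] with s hs
    have hs : 0 < s := hs
    have h1 : Tendsto (fun x : ℝ => ((Real.exp (-s) * s ^ (p - μ) : ℝ) : ℂ) *
        ((((s * x)⁻¹ : ℝ) : ℂ) + Complex.I) ^ (-μ : ℂ)) atTop
        (𝓝 (((Real.exp (-s) * s ^ (p - μ) : ℝ) : ℂ) * Complex.I ^ (-μ : ℂ))) := by
      refine Tendsto.const_mul _ ?_
      have h2 : Tendsto (fun x : ℝ => (((s * x)⁻¹ : ℝ) : ℂ) + Complex.I) atTop (𝓝 Complex.I) := by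
        have h3 : Tendsto (fun x : ℝ => (s * x)⁻¹) atTop (𝓝 0) :=
          (tendsto_id.const_mul_atTop hs).inv_tendsto_atTop
        have h4 := ((Complex.continuous_ofReal.tendsto 0).comp h3).add_const Complex.I
        simpa using h4
      exact (Complex.hasStrictDerivAt_cpow_const
        (Or.inr (by simp))).hasDerivAt.continuousAt.tendsto.comp h2
    refine h1.congr' ?_
    filter_upwards [eventually_gt_atTop 0] with x hx
    exact (hInt hx hs).symm

lemma gammaKernel_re_pos {p μ : ℝ} (hp : -1 < p) (hμ0 : 0 ≤ μ) (hμ1 : μ < 1) (x : ℝ) :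
    0 < (gammaKernel p (-μ) x).re := by
  have hInt := integrableOn_gammaKernelIntegrand hp (neg_nonpos.2 hμ0) x
  have hre : (gammaKernel p (-μ) x).re =
      ∫ s in Ioi (0 : ℝ), (gammaKernelIntegrand p (-μ) x s).re :=
    (integral_re hInt).symm
  have hpos : ∀ s ∈ Ioi (0 : ℝ), 0 < (gammaKernelIntegrand p (-μ) x s).re := by
    intro s hs
    have hs : 0 < s := hs
    rw [gammaKernelIntegrand, Complex.re_ofReal_mul, Complex.cpow_ofReal_re]
    have h1 := one_le_norm_one_add_I s x
    have h2 : |Complex.arg (1 + Complex.I * s * x)| ≤ Real.pi / 2 := by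
      rw [Complex.abs_arg_le_pi_div_two_iff, one_add_I_re]; exact zero_le_one
    have h3 : |Complex.arg (1 + Complex.I * s * x) * -μ| < Real.pi / 2 := by
      rw [abs_mul, abs_neg, abs_of_nonneg hμ0]
      nlinarith [Real.pi_pos, abs_nonneg (Complex.arg (1 + Complex.I * s * x))]
    have h4 := Real.cos_pos_of_mem_Ioo (abs_lt.1 h3)
    have : 0 < ‖1 + Complex.I * s * x‖ := by linarith
    positivity
  rw [hre, setIntegral_pos_iff_support_of_nonneg_ae]
  · have : Function.support (fun s => (gammaKernelIntegrand p (-μ) x s).re) ∩ Ioi 0 = Ioi 0 :=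
      inter_eq_right.2 fun s hs => (hpos s hs).ne'
    rw [this]
    simp
  · filter_upwards [ae_restrict_mem measurableSet_Ioi] with s hs
    exact (hpos s hs).le
  · exact hInt.re

lemma gammaKernel_im_nonpos {p μ : ℝ} (hp : -1 < p) (hμ0 : 0 ≤ μ) (hμ1 : μ < 1) {x : ℝ}
    (hx : 0 ≤ x) : (gammaKernel p (-μ) x).im ≤ 0 := by
  have hInt := integrableOn_gammaKernelIntegrand hp (neg_nonpos.2 hμ0) x
  have him : (gammaKernel p (-μ) x).im =
      ∫ s in Ioi (0 : ℝ), (gammaKernelIntegrand p (-μ) x s).im :=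
    (integral_im hInt).symm
  rw [him]
  refine setIntegral_nonpos measurableSet_Ioi fun s hs => ?_
  have hs : 0 < s := hs
  rw [gammaKernelIntegrand, Complex.im_ofReal_mul, Complex.cpow_ofReal_im]
  have h0 : 0 ≤ Complex.arg (1 + Complex.I * s * x) := by
    rw [Complex.arg_nonneg_iff, one_add_I_im]; positivity
  have h1 := Complex.arg_le_pi (1 + Complex.I * s * x)
  have h2 : 0 ≤ Real.sin (Complex.arg (1 + Complex.I * s * x) * μ) :=
    Real.sin_nonneg_of_nonneg_of_le_pi (by positivity) (by nlinarith [Real.pi_pos])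
  rw [mul_neg, Real.sin_neg]
  have h3 : 0 ≤ Real.exp (-s) * s ^ p * (‖1 + Complex.I * s * x‖ ^ (-μ) *
    Real.sin (Complex.arg (1 + Complex.I * s * x) * μ)) := by positivity
  linarith

/-- `e^{iz} ∫₀^∞ e^{-s} s^{-μ} (1 + i s / (2 z))^{-μ} ds`, a Hankel-type solution of
`y'' + (1 + μ (1 - μ) / z²) y = 0`. -/
noncomputable def hankelSol (μ z : ℝ) : ℂ :=
  Complex.exp (Complex.I * z) * gammaKernel (-μ) (-μ) (1 / (2 * z))

/-- The derivative of `hankelSol`. -/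
noncomputable def hankelSolDeriv (μ z : ℝ) : ℂ :=
  Complex.exp (Complex.I * z) * (Complex.I * gammaKernel (-μ) (-μ) (1 / (2 * z)) +
    Complex.I * μ * gammaKernel (-μ + 1) (-μ - 1) (1 / (2 * z)) * ((1 / (2 * z ^ 2) : ℝ) : ℂ))

lemma hasDerivAt_exp_I_mul (z : ℝ) :
    HasDerivAt (fun z : ℝ => Complex.exp (Complex.I * z))
      (Complex.exp (Complex.I * z) * Complex.I) z := by
  have h1 : HasDerivAt (fun y : ℝ => Complex.I * (y : ℂ)) Complex.I z := by
    simpa using (Complex.ofRealCLM.hasDerivAt (x := z)).const_mul Complex.I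
  exact h1.cexp

lemma hasDerivAt_half_inv {z : ℝ} (hz : 0 < z) :
    HasDerivAt (fun z : ℝ => 1 / (2 * z)) (-(1 / (2 * z ^ 2))) z := by
  have h := (((hasDerivAt_id z).const_mul 2).inv (by simpa using hz.ne'))
  simp only [one_div]
  refine h.congr_deriv ?_
  simp only [id]
  field_simp

lemma hasDerivAt_gammaKernel_half_inv {p m z : ℝ} (hp : -1 < p) (hm : m ≤ 0) (hz : 0 < z) :
    HasDerivAt (fun z : ℝ => gammaKernel p m (1 / (2 * z)))
      (-(Complex.I * m * gammaKernel (p + 1) (m - 1) (1 / (2 * z)) *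
        ((1 / (2 * z ^ 2) : ℝ) : ℂ))) z := by
  have h := (hasDerivAt_gammaKernel hp hm (1 / (2 * z))).scomp z (hasDerivAt_half_inv hz)
  refine h.congr_deriv ?_
  rw [Complex.real_smul]
  push_cast
  ring

lemma hasDerivAt_hankelSol {μ z : ℝ} (hμ0 : 0 ≤ μ) (hμ1 : μ < 1) (hz : 0 < z) :
    HasDerivAt (hankelSol μ) (hankelSolDeriv μ z) z := by
  have h := (hasDerivAt_exp_I_mul z).mul
    (hasDerivAt_gammaKernel_half_inv (p := -μ) (m := -μ) (by linarith) (by linarith) hz)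
  refine h.congr_deriv ?_
  rw [hankelSolDeriv]
  push_cast
  ring

lemma gammaKernel_second_order {μ : ℝ} (hμ0 : 0 ≤ μ) (hμ1 : μ < 1) (x : ℝ) :
    (1 - μ) * gammaKernel (-μ) (-μ) x - (1 + 2 * Complex.I * x) * gammaKernel (-μ + 1) (-μ - 1) x -
      (μ + 1) * x ^ 2 * gammaKernel (-μ + 1 + 1) (-μ - 1 - 1) x = 0 := by
  have h1 := gammaKernel_parts (p := -μ) (m := -μ - 1) (by linarith) (by linarith) x
  have h2 := gammaKernel_add_one (p := -μ) (m := -μ - 1) (by linarith) (by linarith) x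
  have h3 := gammaKernel_add_one (p := -μ + 1) (m := -μ - 1 - 1) (by linarith) (by linarith) x
  rw [sub_add_cancel] at h2 h3
  push_cast at h1
  linear_combination h1 + (1 - μ) * h2 - (μ + 1) * Complex.I * x * h3 -
    (μ + 1) * x ^ 2 * gammaKernel (-μ + 1 + 1) (-μ - 1 - 1) x * Complex.I_sq

lemma hasDerivAt_hankelSolDeriv {μ z : ℝ} (hμ0 : 0 ≤ μ) (hμ1 : μ < 1) (hz : 0 < z) :
    HasDerivAt (hankelSolDeriv μ)
      (((-(1 + μ * (1 - μ) / z ^ 2) : ℝ) : ℂ) * hankelSol μ z) z := by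
  have hA := hasDerivAt_gammaKernel_half_inv (p := -μ) (m := -μ) (by linarith) (by linarith) hz
  have hB := hasDerivAt_gammaKernel_half_inv (p := -μ + 1) (m := -μ - 1) (by linarith)
    (by linarith) hz
  have hz2 : HasDerivAt (fun z : ℝ => 1 / (2 * z ^ 2)) (-(1 / z ^ 3)) z := by
    have h := (((hasDerivAt_pow 2 z).const_mul 2).inv (by positivity))
    simp only [one_div]
    refine h.congr_deriv ?_
    field_simp
    norm_num
  have h := (hasDerivAt_exp_I_mul z).mul ((hA.const_mul Complex.I).add
    ((hB.const_mul (Complex.I * μ)).mul hz2.ofReal_comp))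
  refine h.congr_deriv ?_
  have hne : (z : ℂ) ≠ 0 := by exact_mod_cast hz.ne'
  have e := gammaKernel_second_order hμ0 hμ1 (1 / (2 * z))
  rw [hankelSol]
  simp only [Pi.add_apply, Pi.mul_apply]
  push_cast at e ⊢
  generalize gammaKernel (-μ) (-μ) (1 / (2 * z)) = A at *
  generalize gammaKernel (-μ + 1) (-μ - 1) (1 / (2 * z)) = B at *
  generalize gammaKernel (-μ + 1 + 1) (-μ - 1 - 1) (1 / (2 * z)) = C at *
  generalize Complex.exp (Complex.I * z) = w
  have hI := Complex.I_sq
  generalize Complex.I = i at *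
  field_simp at e ⊢
  linear_combination (4 * w * A * z ^ 4 + 4 * w * μ * B * z ^ 2) * hI + w * μ * e +
    w * C * μ * (μ + 1) * hI

lemma hankelSol_first_order {μ z : ℝ} (hμ0 : 0 ≤ μ) (hμ1 : μ < 1) (hz : 0 < z) :
    hankelSolDeriv μ z = Complex.exp (Complex.I * z) *
      (Complex.I * gammaKernel (-μ) (-μ) (1 / (2 * z)) +
        ((1 - μ) * gammaKernel (-μ) (-μ) (1 / (2 * z)) -
          gammaKernel (-μ + 1) (-μ) (1 / (2 * z))) / z) := by
  have h1 := gammaKernel_parts (p := -μ) (m := -μ) (by linarith) (by linarith) (1 / (2 * z))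
  have hne : (z : ℂ) ≠ 0 := by exact_mod_cast hz.ne'
  rw [hankelSolDeriv]
  push_cast at h1 ⊢
  field_simp at h1 ⊢
  linear_combination (-1 : ℂ) * h1

lemma norm_exp_I_mul (z : ℝ) : ‖Complex.exp (Complex.I * z)‖ = 1 := by
  rw [mul_comm]; exact Complex.norm_exp_ofReal_mul_I z

lemma conj_exp_I_mul (z : ℝ) :
    (starRingEnd ℂ) (Complex.exp (Complex.I * z)) * Complex.exp (Complex.I * z) = 1 := by
  rw [mul_comm, Complex.mul_conj, Complex.normSq_eq_norm_sq, norm_exp_I_mul]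
  simp

lemma normSq_hankelSol (μ z : ℝ) :
    Complex.normSq (hankelSol μ z) = Complex.normSq (gammaKernel (-μ) (-μ) (1 / (2 * z))) := by
  rw [hankelSol, map_mul, Complex.normSq_eq_norm_sq (Complex.exp _), norm_exp_I_mul]
  simp

lemma normSq_hankelSol_le {μ : ℝ} (hμ0 : 0 ≤ μ) (hμ1 : μ < 1) (z : ℝ) :
    Complex.normSq (hankelSol μ z) ≤ Real.Gamma (1 - μ) ^ 2 := by
  rw [normSq_hankelSol, Complex.normSq_eq_norm_sq]
  have h := norm_gammaKernel_le (p := -μ) (m := -μ) (by linarith) (by linarith) (1 / (2 * z))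
  rw [neg_add_eq_sub] at h
  exact pow_le_pow_left₀ (norm_nonneg _) h 2

lemma tendsto_half_inv_atTop : Tendsto (fun z : ℝ => 1 / (2 * z)) atTop (𝓝 0) := by
  simp only [one_div]
  exact (tendsto_id.const_mul_atTop two_pos).inv_tendsto_atTop

lemma tendsto_gammaKernel_half_inv {p m : ℝ} (hp : -1 < p) (hm : m ≤ 0) :
    Tendsto (fun z : ℝ => gammaKernel p m (1 / (2 * z))) atTop (𝓝 (Real.Gamma (p + 1))) := by
  rw [← gammaKernel_zero hp m]
  exact ((continuous_gammaKernel hp hm).tendsto 0).comp tendsto_half_inv_atTop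

lemma tendsto_hankelSol_mul_exp {μ : ℝ} (hμ0 : 0 ≤ μ) (hμ1 : μ < 1) :
    Tendsto (fun z : ℝ => hankelSol μ z * (starRingEnd ℂ) (Complex.exp (Complex.I * z))) atTop
      (𝓝 (Real.Gamma (1 - μ))) := by
  have h := tendsto_gammaKernel_half_inv (p := -μ) (m := -μ) (by linarith) (by linarith)
  rw [neg_add_eq_sub] at h
  refine h.congr fun z => ?_
  rw [hankelSol]
  linear_combination (-gammaKernel (-μ) (-μ) (1 / (2 * z))) * conj_exp_I_mul z

lemma tendsto_hankelSolDeriv_mul_exp {μ : ℝ} (hμ0 : 0 ≤ μ) (hμ1 : μ < 1) :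
    Tendsto (fun z : ℝ => hankelSolDeriv μ z * (starRingEnd ℂ) (Complex.exp (Complex.I * z))) atTop
      (𝓝 (Complex.I * Real.Gamma (1 - μ))) := by
  have hA := tendsto_gammaKernel_half_inv (p := -μ) (m := -μ) (by linarith) (by linarith)
  have hB := tendsto_gammaKernel_half_inv (p := -μ + 1) (m := -μ - 1) (by linarith) (by linarith)
  rw [neg_add_eq_sub] at hA
  have hz2 : Tendsto (fun z : ℝ => ((1 / (2 * z ^ 2) : ℝ) : ℂ)) atTop (𝓝 ((0 : ℝ) : ℂ)) := by
    refine (Complex.continuous_ofReal.tendsto 0).comp ?_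
    simp only [one_div]
    exact ((tendsto_pow_atTop two_ne_zero).const_mul_atTop two_pos).inv_tendsto_atTop
  have h := (hA.const_mul Complex.I).add ((hB.const_mul (Complex.I * μ)).mul hz2)
  rw [Complex.ofReal_zero, mul_zero, add_zero] at h
  refine h.congr fun z => ?_
  rw [hankelSolDeriv]
  linear_combination (-(Complex.I * gammaKernel (-μ) (-μ) (1 / (2 * z)) +
    Complex.I * μ * gammaKernel (-μ + 1) (-μ - 1) (1 / (2 * z)) * ((1 / (2 * z ^ 2) : ℝ) : ℂ))) *
      conj_exp_I_mul z

lemma tendsto_conj_hankelSol_mul_deriv {μ : ℝ} (hμ0 : 0 ≤ μ) (hμ1 : μ < 1) :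
    Tendsto (fun z : ℝ => (starRingEnd ℂ) (hankelSol μ z) * hankelSolDeriv μ z) atTop
      (𝓝 (Complex.I * (Real.Gamma (1 - μ) ^ 2 : ℝ))) := by
  have h1 := (Complex.continuous_conj.tendsto _).comp (tendsto_hankelSol_mul_exp hμ0 hμ1)
  have h := h1.mul (tendsto_hankelSolDeriv_mul_exp hμ0 hμ1)
  rw [Complex.conj_ofReal] at h
  convert h using 2 with z
  · simp only [Function.comp, map_mul, Complex.conj_conj]
    linear_combination (-(starRingEnd ℂ) (hankelSol μ z) * hankelSolDeriv μ z) * conj_exp_I_mul z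
  · push_cast; ring

lemma tendsto_normSq_hankelSol {μ : ℝ} (hμ0 : 0 ≤ μ) (hμ1 : μ < 1) :
    Tendsto (fun z : ℝ => Complex.normSq (hankelSol μ z)) atTop (𝓝 (Real.Gamma (1 - μ) ^ 2)) := by
  have h := (Complex.continuous_normSq.tendsto _).comp (tendsto_hankelSol_mul_exp hμ0 hμ1)
  rw [Complex.normSq_ofReal, ← sq] at h
  refine h.congr fun z => ?_
  simp only [Function.comp, map_mul, Complex.normSq_conj]
  rw [Complex.normSq_eq_norm_sq (Complex.exp _), norm_exp_I_mul]
  simp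

lemma tendsto_normSq_hankelSolDeriv {μ : ℝ} (hμ0 : 0 ≤ μ) (hμ1 : μ < 1) :
    Tendsto (fun z : ℝ => Complex.normSq (hankelSolDeriv μ z)) atTop
      (𝓝 (Real.Gamma (1 - μ) ^ 2)) := by
  have h := (Complex.continuous_normSq.tendsto _).comp (tendsto_hankelSolDeriv_mul_exp hμ0 hμ1)
  rw [map_mul, Complex.normSq_I, one_mul, Complex.normSq_ofReal, ← sq] at h
  refine h.congr fun z => ?_
  simp only [Function.comp, map_mul, Complex.normSq_conj]
  rw [Complex.normSq_eq_norm_sq (Complex.exp _), norm_exp_I_mul]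
  simp

lemma HasDerivAt.re_ofComplex {f : ℝ → ℂ} {f' : ℂ} {t : ℝ} (h : HasDerivAt f f' t) :
    HasDerivAt (fun t => (f t).re) f'.re t :=
  Complex.reCLM.hasFDerivAt.comp_hasDerivAt t h

lemma HasDerivAt.im_ofComplex {f : ℝ → ℂ} {f' : ℂ} {t : ℝ} (h : HasDerivAt f f' t) :
    HasDerivAt (fun t => (f t).im) f'.im t :=
  Complex.imCLM.hasFDerivAt.comp_hasDerivAt t h

/-- The Wronskian of two solutions of the same equation `y'' = q y` is constant on `(0, ∞)`, equal
to its limit at infinity. -/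
lemma wronskian_eq_of_tendsto {q : ℝ → ℂ} {f f' g g' : ℝ → ℂ} {l : ℂ}
    (hf : ∀ z, 0 < z → HasDerivAt f (f' z) z) (hf' : ∀ z, 0 < z → HasDerivAt f' (q z * f z) z)
    (hg : ∀ z, 0 < z → HasDerivAt g (g' z) z) (hg' : ∀ z, 0 < z → HasDerivAt g' (q z * g z) z)
    (hl : Tendsto (fun z => f z * g' z - f' z * g z) atTop (𝓝 l)) {z : ℝ} (hz : 0 < z) :
    f z * g' z - f' z * g z = l := by
  have hd : ∀ y ∈ Ioi (0 : ℝ), HasDerivAt (fun z => f z * g' z - f' z * g z) 0 y := by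
    intro y hy
    refine (((hf y hy).mul (hg' y hy)).sub ((hf' y hy).mul (hg y hy))).congr_deriv ?_
    ring
  refine tendsto_nhds_unique ?_ hl
  refine tendsto_const_nhds.congr' ?_
  filter_upwards [eventually_gt_atTop 0] with y hy
  exact isOpen_Ioi.is_const_of_deriv_eq_zero isPreconnected_Ioi
    (fun y hy => (hd y hy).differentiableAt.differentiableWithinAt)
    (fun y hy => (hd y hy).deriv) hz hy

lemma hankelSol_wronskian {μ z : ℝ} (hμ0 : 0 ≤ μ) (hμ1 : μ < 1) (hz : 0 < z) :
    (hankelSol μ z).re * (hankelSolDeriv μ z).im - (hankelSolDeriv μ z).re * (hankelSol μ z).im =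
      Real.Gamma (1 - μ) ^ 2 := by
  have hlim := (Complex.continuous_im.tendsto _).comp (tendsto_conj_hankelSol_mul_deriv hμ0 hμ1)
  have h := wronskian_eq_of_tendsto (q := fun z => ((-(1 + μ * (1 - μ) / z ^ 2) : ℝ) : ℂ))
    (f := fun z => ((hankelSol μ z).re : ℂ)) (f' := fun z => ((hankelSolDeriv μ z).re : ℂ))
    (g := fun z => ((hankelSol μ z).im : ℂ)) (g' := fun z => ((hankelSolDeriv μ z).im : ℂ))
    (l := ((Real.Gamma (1 - μ) ^ 2 : ℝ) : ℂ))
    (fun z hz => (hasDerivAt_hankelSol hμ0 hμ1 hz).re_ofComplex.ofReal_comp)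
    (fun z hz => by
      have := (hasDerivAt_hankelSolDeriv hμ0 hμ1 hz).re_ofComplex.ofReal_comp
      rwa [Complex.re_ofReal_mul, Complex.ofReal_mul] at this)
    (fun z hz => (hasDerivAt_hankelSol hμ0 hμ1 hz).im_ofComplex.ofReal_comp)
    (fun z hz => by
      have := (hasDerivAt_hankelSolDeriv hμ0 hμ1 hz).im_ofComplex.ofReal_comp
      rwa [Complex.im_ofReal_mul, Complex.ofReal_mul] at this) ?_ hz
  · exact_mod_cast h
  · have := (Complex.continuous_ofReal.tendsto _).comp hlim
    convert this using 2 with z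
    · simp only [Function.comp, Complex.mul_im, Complex.conj_re, Complex.conj_im]
      push_cast
      ring
    · rw [Complex.I_mul_im, Complex.ofReal_re]

lemma modulus_deriv_nonneg {a a' b b' : ℝ → ℝ} {κ M : ℝ} (hκ : 0 ≤ κ)
    (ha : ∀ z, 0 < z → HasDerivAt a (a' z) z)
    (ha' : ∀ z, 0 < z → HasDerivAt a' (-(1 + κ / z ^ 2) * a z) z)
    (hb : ∀ z, 0 < z → HasDerivAt b (b' z) z)
    (hb' : ∀ z, 0 < z → HasDerivAt b' (-(1 + κ / z ^ 2) * b z) z)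
    (hlog : ∀ z, 0 < z → z * (2 * (a z * a' z + b z * b' z)) ≤ a z ^ 2 + b z ^ 2)
    (hG : Tendsto (fun z => a z ^ 2 + b z ^ 2) atTop (𝓝 M))
    (hG' : Tendsto (fun z => a z * a' z + b z * b' z) atTop (𝓝 0))
    (hL : Tendsto (fun z => a' z ^ 2 + b' z ^ 2) atTop (𝓝 M)) {z : ℝ} (hz : 0 < z) :
    0 ≤ a z * a' z + b z * b' z := by
  set D : ℝ → ℝ := fun z => 2 * (a z * a' z + b z * b' z) with hD
  set H : ℝ → ℝ := fun z => 2 * (a' z ^ 2 + b' z ^ 2) - 2 * (1 + κ / z ^ 2) * (a z ^ 2 + b z ^ 2)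
    with hH
  set r : ℝ → ℝ := fun z => κ * (a z ^ 2 + b z ^ 2) / (z ^ 3 + κ * z) with hr
  set r' : ℝ → ℝ := fun z => (κ * D z * (z ^ 3 + κ * z) -
    κ * (a z ^ 2 + b z ^ 2) * (3 * z ^ 2 + κ)) / (z ^ 3 + κ * z) ^ 2 with hr'
  set E : ℝ → ℝ := fun z => H z ^ 2 / (4 * (1 + κ / z ^ 2)) + (D z - r z) ^ 2 with hE
  have dG : ∀ z, 0 < z → HasDerivAt (fun z => a z ^ 2 + b z ^ 2) (D z) z := fun z hz => by
    refine (((ha z hz).pow 2).add ((hb z hz).pow 2)).congr_deriv ?_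
    simp only [hD]; ring
  have dq : ∀ z : ℝ, 0 < z → HasDerivAt (fun z => 1 + κ / z ^ 2) (-2 * κ / z ^ 3) z :=
    fun z hz => by
      refine (((hasDerivAt_const z κ).div (hasDerivAt_pow 2 z) (by positivity)).const_add
        1).congr_deriv ?_
      have := hz.ne'
      simp
      field_simp
  have dD : ∀ z, 0 < z → HasDerivAt D (H z) z := fun z hz => by
    refine ((((ha z hz).mul (ha' z hz)).add ((hb z hz).mul (hb' z hz))).const_mul 2).congr_deriv ?_
    simp only [hH]; ring
  have dH : ∀ z, 0 < z → HasDerivAt H (4 * (1 + κ / z ^ 2) * (r z - D z)) z := fun z hz => by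
    refine (((((ha' z hz).pow 2).add ((hb' z hz).pow 2)).const_mul 2).sub
      (((dq z hz).const_mul 2).mul (dG z hz))).congr_deriv ?_
    simp only [hr, hD]
    have := hz.ne'
    have : z ^ 2 + κ ≠ 0 := by positivity
    have : z ^ 3 + κ * z ≠ 0 := by positivity
    field_simp
    ring
  have dr : ∀ z, 0 < z → HasDerivAt r (r' z) z := fun z hz => by
    refine (((dG z hz).const_mul κ).div ((hasDerivAt_pow 3 z).add
      ((hasDerivAt_id z).const_mul κ)) (by simp only [Pi.add_apply, id]; positivity)).congr_deriv ?_
    simp [hr']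
  have hr'0 : ∀ z, 0 < z → r' z ≤ 0 := fun z hz => by
    refine div_nonpos_of_nonpos_of_nonneg ?_ (by positivity)
    have h1 := hlog z hz
    have h2 : κ * D z * (z ^ 3 + κ * z) = κ * (z * D z) * (z ^ 2 + κ) := by ring
    have h3 : κ * (z * D z) * (z ^ 2 + κ) ≤ κ * (a z ^ 2 + b z ^ 2) * (z ^ 2 + κ) := by gcongr
    have h4 : 0 ≤ κ * (a z ^ 2 + b z ^ 2) * (2 * z ^ 2) := by positivity
    rw [h2]
    linarith
  have dE : ∀ z, 0 < z → HasDerivAt E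
      ((2 * κ / z ^ 3) * H z ^ 2 / (4 * (1 + κ / z ^ 2) ^ 2) - 2 * (D z - r z) * r' z) z :=
    fun z hz => by
      have hq : 0 < 1 + κ / z ^ 2 := by positivity
      refine ((((dH z hz).pow 2).div ((dq z hz).const_mul 4) (by positivity)).add
        (((dD z hz).sub (dr z hz)).pow 2)).congr_deriv ?_
      have := hz.ne'
      simp only [Pi.sub_apply, Pi.pow_apply]
      generalize r' z = x1
      generalize r z = x2
      generalize D z = x3
      generalize H z = x4
      have : z ^ 2 + κ ≠ 0 := by positivity
      field_simp
      ring
  have hinv : Tendsto (fun z : ℝ => κ / z ^ 2) atTop (𝓝 0) :=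
    tendsto_const_nhds.div_atTop (tendsto_pow_atTop two_ne_zero)
  have hq : Tendsto (fun z : ℝ => 1 + κ / z ^ 2) atTop (𝓝 1) := by
    simpa using hinv.const_add 1
  have lH : Tendsto H atTop (𝓝 0) := by
    have := (hL.const_mul 2).sub ((hq.const_mul 2).mul hG)
    simpa using this
  have lD : Tendsto D atTop (𝓝 0) := by simpa using hG'.const_mul 2
  have lr : Tendsto r atTop (𝓝 0) := by
    refine (hG.const_mul κ).div_atTop ?_
    refine tendsto_atTop_mono' _ ?_ (tendsto_pow_atTop (α := ℝ) three_ne_zero)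
    filter_upwards [eventually_gt_atTop 0] with z hz
    have : 0 ≤ κ * z := by positivity
    linarith
  have lE : Tendsto E atTop (𝓝 0) := by
    have := ((lH.pow 2).div (hq.const_mul 4) (by norm_num)).add ((lD.sub lr).pow 2)
    simpa using this
  have hE0 : ∀ z, 0 < z → 0 ≤ E z := fun z hz => by simp only [hE]; positivity
  have main : ∀ ε > 0, √(E z + ε) - r z ≤ √ε := by
    intro ε hε
    have dF : ∀ z, 0 < z → HasDerivAt (fun z => √(E z + ε) - r z)
        (((2 * κ / z ^ 3) * H z ^ 2 / (4 * (1 + κ / z ^ 2) ^ 2) - 2 * (D z - r z) * r' z) /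
          (2 * √(E z + ε)) - r' z) z := fun z hz =>
      (((dE z hz).add_const ε).sqrt (by linarith [hE0 z hz])).sub (dr z hz)
    have hm : MonotoneOn (fun z => √(E z + ε) - r z) (Ioi 0) := by
      refine monotoneOn_of_deriv_nonneg (convex_Ioi 0)
        (fun z hz => (dF z hz).continuousAt.continuousWithinAt) ?_ ?_
      · rw [interior_Ioi]
        exact fun z hz => (dF z hz).differentiableAt.differentiableWithinAt
      · rw [interior_Ioi]
        intro z hz
        have hz : 0 < z := hz
        rw [(dF z hz).deriv]
        have hs : 0 < √(E z + ε) := Real.sqrt_pos.2 (by linarith [hE0 z hz])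
        rw [sub_nonneg, le_div_iff₀ (by positivity)]
        have h1 : -(D z - r z) ≤ √(E z + ε) := by
          refine (neg_le_abs _).trans (Real.abs_le_sqrt ?_)
          have : 0 ≤ H z ^ 2 / (4 * (1 + κ / z ^ 2)) := by positivity
          simp only [hE]
          linarith
        have h2 : 0 ≤ (2 * κ / z ^ 3) * H z ^ 2 / (4 * (1 + κ / z ^ 2) ^ 2) := by positivity
        nlinarith [mul_nonneg (neg_nonneg.2 (hr'0 z hz))
          (by linarith : 0 ≤ √(E z + ε) + (D z - r z))]
    have lF : Tendsto (fun z => √(E z + ε) - r z) atTop (𝓝 √ε) := by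
      simpa using ((lE.add_const ε).sqrt).sub lr
    refine ge_of_tendsto lF ?_
    filter_upwards [eventually_ge_atTop z] with w hw
    exact hm hz (hz.trans_le hw) hw
  have h0 : 0 ≤ D z := by
    have key : ∀ ε > 0, -√ε ≤ D z := by
      intro ε hε
      have h1 : -(D z - r z) ≤ √(E z + ε) := by
        refine (neg_le_abs _).trans (Real.abs_le_sqrt ?_)
        have : 0 ≤ H z ^ 2 / (4 * (1 + κ / z ^ 2)) := by positivity
        simp only [hE]
        linarith
      linarith [main ε hε]
    refine le_of_forall_pos_le_add fun δ hδ => ?_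
    have := key (δ ^ 2) (by positivity)
    rw [Real.sqrt_sq hδ.le] at this
    linarith
  simp only [hD] at h0
  linarith

lemma sonin_antitoneOn {a a' b b' u u' q R R' : ℝ → ℝ} {W L : ℝ} (hW : W ≠ 0)
    (ha : ∀ t ∈ Ioo 0 L, HasDerivAt a (a' t) t)
    (ha' : ∀ t ∈ Ioo 0 L, HasDerivAt a' (-(q t) * a t) t)
    (hb : ∀ t ∈ Ioo 0 L, HasDerivAt b (b' t) t)
    (hb' : ∀ t ∈ Ioo 0 L, HasDerivAt b' (-(q t) * b t) t)
    (hu : ∀ t ∈ Ioo 0 L, HasDerivAt u (u' t) t)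
    (hu' : ∀ t ∈ Ioo 0 L, HasDerivAt u' (-(q t + R t) * u t) t)
    (hR : ∀ t ∈ Ioo 0 L, HasDerivAt R (R' t) t)
    (hR0 : ∀ t ∈ Ioo 0 L, 0 ≤ R t) (hR'0 : ∀ t ∈ Ioo 0 L, 0 ≤ R' t)
    (hWr : ∀ t ∈ Ioo 0 L, a t * b' t - a' t * b t = W)
    (hmono : ∀ t ∈ Ioo 0 L, 0 ≤ a t * a' t + b t * b' t) :
    AntitoneOn (fun t => (W ^ 2 * u t ^ 2 +
      ((a t ^ 2 + b t ^ 2) * u' t - (a t * a' t + b t * b' t) * u t) ^ 2 /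
        (1 + (a t ^ 2 + b t ^ 2) ^ 2 * R t / W ^ 2)) / (a t ^ 2 + b t ^ 2)) (Ioo 0 L) := by
  have key : ∀ t ∈ Ioo 0 L, ∃ d ≤ 0, HasDerivAt (fun t => (W ^ 2 * u t ^ 2 +
      ((a t ^ 2 + b t ^ 2) * u' t - (a t * a' t + b t * b' t) * u t) ^ 2 /
        (1 + (a t ^ 2 + b t ^ 2) ^ 2 * R t / W ^ 2)) / (a t ^ 2 + b t ^ 2)) d t := by
    intro t ht
    have hG : 0 < a t ^ 2 + b t ^ 2 := by
      by_contra h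
      have h1 : a t = 0 := by nlinarith [sq_nonneg (a t), sq_nonneg (b t)]
      have h2 : b t = 0 := by nlinarith [sq_nonneg (a t), sq_nonneg (b t)]
      exact hW (by rw [← hWr t ht, h1, h2]; ring)
    have hW2 : 0 < W ^ 2 := by positivity
    have hT : 0 < 1 + (a t ^ 2 + b t ^ 2) ^ 2 * R t / W ^ 2 := by
      have := hR0 t ht; positivity
    have dG := ((ha t ht).pow 2).add ((hb t ht).pow 2)
    have dA := (dG.mul (hu' t ht)).sub
      ((((ha t ht).mul (ha' t ht)).add ((hb t ht).mul (hb' t ht))).mul (hu t ht))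
    have dT := (((dG.pow 2).mul (hR t ht)).div_const (W ^ 2)).const_add 1
    have dS := ((((hu t ht).pow 2).const_mul (W ^ 2)).add ((dA.pow 2).div dT hT.ne')).div dG hG.ne'
    refine ⟨-((4 * (a t ^ 2 + b t ^ 2) * (a t * a' t + b t * b' t) * R t
      + (a t ^ 2 + b t ^ 2) ^ 2 * R' t) / W ^ 2) *
      ((a t ^ 2 + b t ^ 2) * u' t - (a t * a' t + b t * b' t) * u t) ^ 2 /
      ((1 + (a t ^ 2 + b t ^ 2) ^ 2 * R t / W ^ 2) ^ 2 * (a t ^ 2 + b t ^ 2)), ?_, ?_⟩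
    · have := hR0 t ht
      have := hR'0 t ht
      have := hmono t ht
      rw [neg_mul, neg_div]
      exact neg_nonpos.2 (by positivity)
    · refine dS.congr_deriv ?_
      simp only [Pi.add_apply, Pi.mul_apply, Pi.pow_apply, Pi.sub_apply, Pi.div_apply]
      have e := hWr t ht
      have hW0 := hW
      rw [← e] at hT hW2 hW0 ⊢
      have h1 := hT.ne'
      have h2 := hG.ne'
      have h3 : (a t * b' t - a' t * b t) ^ 2 + (a t ^ 2 + b t ^ 2) ^ 2 * R t ≠ 0 := by
        have := hR0 t ht; positivity
      field_simp
      ring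
  refine antitoneOn_of_deriv_nonpos (convex_Ioo 0 L) ?_ ?_ ?_
  · intro t ht
    obtain ⟨d, -, h⟩ := key t ht
    exact h.continuousAt.continuousWithinAt
  · rw [interior_Ioo]
    intro t ht
    obtain ⟨d, -, h⟩ := key t ht
    exact h.differentiableAt.differentiableWithinAt
  · rw [interior_Ioo]
    intro t ht
    obtain ⟨d, hd, h⟩ := key t ht
    rwa [h.deriv]

lemma sonin_bound {a a' b b' u u' q R R' : ℝ → ℝ} {W L K M : ℝ} (hW : W ≠ 0)
    (ha : ∀ t ∈ Ioo 0 L, HasDerivAt a (a' t) t)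
    (ha' : ∀ t ∈ Ioo 0 L, HasDerivAt a' (-(q t) * a t) t)
    (hb : ∀ t ∈ Ioo 0 L, HasDerivAt b (b' t) t)
    (hb' : ∀ t ∈ Ioo 0 L, HasDerivAt b' (-(q t) * b t) t)
    (hu : ∀ t ∈ Ioo 0 L, HasDerivAt u (u' t) t)
    (hu' : ∀ t ∈ Ioo 0 L, HasDerivAt u' (-(q t + R t) * u t) t)
    (hR : ∀ t ∈ Ioo 0 L, HasDerivAt R (R' t) t)
    (hR0 : ∀ t ∈ Ioo 0 L, 0 ≤ R t) (hR'0 : ∀ t ∈ Ioo 0 L, 0 ≤ R' t)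
    (hWr : ∀ t ∈ Ioo 0 L, a t * b' t - a' t * b t = W)
    (hmono : ∀ t ∈ Ioo 0 L, 0 ≤ a t * a' t + b t * b' t)
    (hM : ∀ t ∈ Ioo 0 L, a t ^ 2 + b t ^ 2 ≤ M)
    (hK : Tendsto (fun t => (a t * u' t - a' t * u t) ^ 2 + (b t * u' t - b' t * u t) ^ 2)
      (𝓝[>] 0) (𝓝 K)) {t : ℝ} (ht : t ∈ Ioo 0 L) :
    W ^ 2 * u t ^ 2 ≤ M * K := by
  have hanti := sonin_antitoneOn hW ha ha' hb hb' hu hu' hR hR0 hR'0 hWr hmono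
  have hGpos : ∀ t ∈ Ioo 0 L, 0 < a t ^ 2 + b t ^ 2 := by
    intro t ht
    by_contra h
    have h1 : a t = 0 := by nlinarith [sq_nonneg (a t), sq_nonneg (b t)]
    have h2 : b t = 0 := by nlinarith [sq_nonneg (a t), sq_nonneg (b t)]
    exact hW (by rw [← hWr t ht, h1, h2]; ring)
  set A : ℝ → ℝ := fun t => (a t ^ 2 + b t ^ 2) * u' t - (a t * a' t + b t * b' t) * u t with hA
  set T : ℝ → ℝ := fun t => (a t ^ 2 + b t ^ 2) ^ 2 * R t / W ^ 2 with hT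
  have hT0 : ∀ t ∈ Ioo 0 L, 0 ≤ T t := fun t ht => by
    have := hR0 t ht; simp only [hT]; positivity
  have hS : (W ^ 2 * u t ^ 2 + A t ^ 2 / (1 + T t)) / (a t ^ 2 + b t ^ 2) ≤ K := by
    refine ge_of_tendsto hK ?_
    filter_upwards [Ioo_mem_nhdsGT ht.1] with s hs
    have hsL : s ∈ Ioo 0 L := ⟨hs.1, hs.2.trans ht.2⟩
    refine (hanti hsL ht hs.2.le).trans ?_
    rw [div_le_iff₀ (hGpos s hsL)]
    have : A s ^ 2 / (1 + T s) ≤ A s ^ 2 := div_le_self (sq_nonneg _) (by linarith [hT0 s hsL])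
    calc _ ≤ W ^ 2 * u s ^ 2 + A s ^ 2 := by gcongr
      _ = _ := by rw [← hWr s hsL]; simp only [hA]; ring
  rw [div_le_iff₀ (hGpos t ht)] at hS
  have h1 : 0 ≤ A t ^ 2 / (1 + T t) := div_nonneg (sq_nonneg _) (by linarith [hT0 t ht])
  have hK0 : 0 ≤ K := ge_of_tendsto hK (Eventually.of_forall fun t => by positivity)
  nlinarith [hM t ht, mul_le_mul_of_nonneg_left (hM t ht) hK0]

lemma conj_mul_re (w z : ℂ) : ((starRingEnd ℂ) w * z).re = w.re * z.re + w.im * z.im := by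
  simp

lemma conj_hankelSol_mul_deriv_re {μ z : ℝ} (hμ0 : 0 ≤ μ) (hμ1 : μ < 1) (hz : 0 < z) :
    z * ((starRingEnd ℂ) (hankelSol μ z) * hankelSolDeriv μ z).re =
      (1 - μ) * Complex.normSq (hankelSol μ z) -
        ((starRingEnd ℂ) (gammaKernel (-μ) (-μ) (1 / (2 * z))) *
          gammaKernel (-μ + 1) (-μ) (1 / (2 * z))).re := by
  rw [normSq_hankelSol, hankelSol_first_order hμ0 hμ1 hz, hankelSol]
  have hne : (z : ℂ) ≠ 0 := by exact_mod_cast hz.ne'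
  set A := gammaKernel (-μ) (-μ) (1 / (2 * z))
  set F := gammaKernel (-μ + 1) (-μ) (1 / (2 * z))
  have e : (z : ℂ) * ((starRingEnd ℂ) (Complex.exp (Complex.I * z) * A) *
      (Complex.exp (Complex.I * z) * (Complex.I * A + ((1 - μ) * A - F) / z))) =
      ((z * Complex.normSq A : ℝ) : ℂ) * Complex.I + ((1 - μ : ℝ) : ℂ) * (Complex.normSq A : ℂ) -
        (starRingEnd ℂ) A * F := by
    have e1 := conj_exp_I_mul z
    have e2 := Complex.mul_conj A
    rw [map_mul]
    generalize Complex.exp (Complex.I * z) = w at *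
    field_simp
    push_cast
    linear_combination ((starRingEnd ℂ) A * (z * Complex.I * A + ((1 - μ) * A - F))) * e1 +
      (z * Complex.I + (1 - μ)) * e2
  have e' := congrArg Complex.re e
  rw [Complex.re_ofReal_mul] at e'
  rw [e']
  simp

lemma hankelSol_modulus_deriv_nonneg_of_half_le {μ z : ℝ} (hμ0 : 1 / 2 ≤ μ) (hμ1 : μ < 1)
    (hz : 0 < z) : 0 ≤ ((starRingEnd ℂ) (hankelSol μ z) * hankelSolDeriv μ z).re := by
  have hμ : 0 ≤ μ := by linarith
  rw [conj_mul_re]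
  refine modulus_deriv_nonneg (a := fun z => (hankelSol μ z).re)
    (a' := fun z => (hankelSolDeriv μ z).re) (b := fun z => (hankelSol μ z).im)
    (b' := fun z => (hankelSolDeriv μ z).im) (κ := μ * (1 - μ)) (M := Real.Gamma (1 - μ) ^ 2)
    (by nlinarith) (fun z hz => (hasDerivAt_hankelSol hμ hμ1 hz).re_ofComplex)
    (fun z hz => by
      have := (hasDerivAt_hankelSolDeriv hμ hμ1 hz).re_ofComplex
      rwa [Complex.re_ofReal_mul] at this)
    (fun z hz => (hasDerivAt_hankelSol hμ hμ1 hz).im_ofComplex)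
    (fun z hz => by
      have := (hasDerivAt_hankelSolDeriv hμ hμ1 hz).im_ofComplex
      rwa [Complex.im_ofReal_mul] at this) ?_ ?_ ?_ ?_ hz
  · intro z hz
    have h := conj_hankelSol_mul_deriv_re hμ hμ1 hz
    have hx : 0 ≤ 1 / (2 * z) := by positivity
    have h1 := gammaKernel_re_pos (p := -μ) (by linarith) hμ hμ1 (1 / (2 * z))
    have h2 := gammaKernel_re_pos (p := -μ + 1) (by linarith) hμ hμ1 (1 / (2 * z))
    have h3 := gammaKernel_im_nonpos (p := -μ) (by linarith) hμ hμ1 hx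
    have h4 := gammaKernel_im_nonpos (p := -μ + 1) (by linarith) hμ hμ1 hx
    rw [conj_mul_re, conj_mul_re, Complex.normSq_apply] at h
    have h5 := mul_pos h1 h2
    have h6 := mul_nonneg_of_nonpos_of_nonpos h3 h4
    nlinarith [mul_self_nonneg (hankelSol μ z).re, mul_self_nonneg (hankelSol μ z).im]
  · refine (tendsto_normSq_hankelSol hμ hμ1).congr fun z => ?_
    rw [Complex.normSq_apply]; ring
  · have := (Complex.continuous_re.tendsto _).comp (tendsto_conj_hankelSol_mul_deriv hμ hμ1)
    rw [Complex.I_mul_re, Complex.ofReal_im, neg_zero] at this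
    exact this.congr fun z => conj_mul_re _ _
  · refine (tendsto_normSq_hankelSolDeriv hμ hμ1).congr fun z => ?_
    rw [Complex.normSq_apply]; ring

lemma hankelSol_ne_zero {μ : ℝ} (hμ0 : 0 ≤ μ) (hμ1 : μ < 1) (z : ℝ) : hankelSol μ z ≠ 0 := by
  have h := gammaKernel_re_pos (p := -μ) (by linarith) hμ0 hμ1 (1 / (2 * z))
  refine mul_ne_zero (Complex.exp_ne_zero _) fun h0 => ?_
  rw [h0] at h
  simp at h

lemma hankelSol_mul_deriv_eq {μ z : ℝ} (hμ0 : 0 < μ) (hμ1 : μ < 1) (hz : 0 < z) :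
    hankelSol μ z * hankelSolDeriv (1 - μ) z - hankelSolDeriv μ z * hankelSol (1 - μ) z = 0 := by
  have hν0 : 0 ≤ 1 - μ := by linarith
  have hν1 : 1 - μ < 1 := by linarith
  refine wronskian_eq_of_tendsto (q := fun z => ((-(1 + μ * (1 - μ) / z ^ 2) : ℝ) : ℂ))
    (fun z hz => hasDerivAt_hankelSol hμ0.le hμ1 hz)
    (fun z hz => hasDerivAt_hankelSolDeriv hμ0.le hμ1 hz)
    (fun z hz => hasDerivAt_hankelSol hν0 hν1 hz)
    (fun z hz => by
      refine (hasDerivAt_hankelSolDeriv hν0 hν1 hz).congr_deriv ?_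
      rw [sub_sub_cancel, mul_comm (1 - μ) μ]) ?_ hz
  have h := ((tendsto_hankelSol_mul_exp hμ0.le hμ1).mul
    (tendsto_hankelSolDeriv_mul_exp hν0 hν1)).sub
    ((tendsto_hankelSolDeriv_mul_exp hμ0.le hμ1).mul (tendsto_hankelSol_mul_exp hν0 hν1))
  have h0 : (Real.Gamma (1 - μ) * (Complex.I * Real.Gamma (1 - (1 - μ))) -
    Complex.I * Real.Gamma (1 - μ) * Real.Gamma (1 - (1 - μ)) : ℂ) = 0 := by ring
  rw [h0] at h
  rw [tendsto_zero_iff_norm_tendsto_zero] at h ⊢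
  refine h.congr fun z => ?_
  have e : ∀ a b c d w : ℂ, a * w * (b * w) - c * w * (d * w) = (a * b - c * d) * w * w := by
    intros; ring
  rw [e, norm_mul, norm_mul, RCLike.norm_conj, norm_exp_I_mul, mul_one, mul_one]

lemma hankelSol_modulus_deriv_nonneg {μ z : ℝ} (hμ0 : 0 ≤ μ) (hμ1 : μ < 1) (hz : 0 < z) :
    0 ≤ ((starRingEnd ℂ) (hankelSol μ z) * hankelSolDeriv μ z).re := by
  rcases le_or_gt (1 / 2) μ with h | h
  · exact hankelSol_modulus_deriv_nonneg_of_half_le h hμ1 hz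
  rcases hμ0.eq_or_lt with h0 | h0
  · have e : (starRingEnd ℂ) (hankelSol μ z) * hankelSolDeriv μ z =
        Complex.I * (Complex.normSq (hankelSol μ z) : ℂ) := by
      rw [← Complex.mul_conj, hankelSolDeriv, hankelSol, ← h0]
      push_cast
      ring
    rw [e, Complex.I_mul_re, Complex.ofReal_im, neg_zero]
  have hν0 : 0 ≤ 1 - μ := by linarith
  have hν1 : 1 - μ < 1 := by linarith
  have hne : ∀ y, hankelSol (1 - μ) y ≠ 0 := hankelSol_ne_zero hν0 hν1
  have hd : ∀ y ∈ Ioi (0 : ℝ), HasDerivAt (fun y => hankelSol μ y / hankelSol (1 - μ) y) 0 y := by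
    intro y hy
    refine ((hasDerivAt_hankelSol hμ0 hμ1 hy).div (hasDerivAt_hankelSol hν0 hν1 hy)
      (hne y)).congr_deriv ?_
    rw [div_eq_zero_iff]
    left
    linear_combination -hankelSol_mul_deriv_eq h0 hμ1 hy
  set c := hankelSol μ z / hankelSol (1 - μ) z with hc
  have e1 : hankelSol μ z = c * hankelSol (1 - μ) z := by rw [hc, div_mul_cancel₀ _ (hne z)]
  have e2 : hankelSolDeriv μ z = c * hankelSolDeriv (1 - μ) z := by
    refine mul_right_cancel₀ (hne z) ?_
    linear_combination hankelSolDeriv (1 - μ) z * e1 - hankelSol_mul_deriv_eq h0 hμ1 hz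
  have e3 : (starRingEnd ℂ) (hankelSol μ z) * hankelSolDeriv μ z = (Complex.normSq c : ℂ) *
      ((starRingEnd ℂ) (hankelSol (1 - μ) z) * hankelSolDeriv (1 - μ) z) := by
    rw [e1, e2, ← Complex.mul_conj, map_mul]
    ring
  rw [e3, Complex.re_ofReal_mul]
  exact mul_nonneg (Complex.normSq_nonneg c)
    (hankelSol_modulus_deriv_nonneg_of_half_le (by linarith) hν1 hz)

lemma tendsto_hankelSol_connection {μ : ℝ} (hμ0 : 0 ≤ μ) (hμ1 : μ < 1) :
    ∃ l : ℂ, ‖l‖ = 2 ^ μ * Real.Gamma (2 - 2 * μ) ∧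
      Tendsto (fun z : ℝ => ((z ^ (1 - μ) : ℝ) : ℂ) *
        (hankelSolDeriv μ z - (1 - μ) / z * hankelSol μ z)) (𝓝[>] 0) (𝓝 l) := by
  refine ⟨-(((2 ^ μ : ℝ) : ℂ) * (Real.Gamma (-μ + 1 - μ + 1) * Complex.I ^ (-μ : ℂ))), ?_, ?_⟩
  · have h1 : ‖Complex.I ^ (-μ : ℂ)‖ = 1 := by
      rw [show (-μ : ℂ) = ((-μ : ℝ) : ℂ) by push_cast; rfl, Complex.norm_cpow_real, Complex.norm_I,
        Real.one_rpow]
    have h2 : 0 < Real.Gamma (2 - 2 * μ) := Real.Gamma_pos_of_pos (by linarith)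
    rw [norm_neg, norm_mul, norm_mul, h1, Complex.norm_real, Complex.norm_real,
      show -μ + 1 - μ + 1 = 2 - 2 * μ by ring, Real.norm_of_nonneg h2.le,
      Real.norm_of_nonneg (by positivity), mul_one]
  · have hx : Tendsto (fun z : ℝ => 1 / (2 * z)) (𝓝[>] 0) atTop := by
      have h1 : Tendsto (fun z : ℝ => z⁻¹ * (1 / 2)) (𝓝[>] 0) atTop :=
        tendsto_inv_nhdsGT_zero.atTop_mul_const (by norm_num)
      refine h1.congr fun z => ?_
      rw [one_div, one_div, mul_inv, mul_comm]
    have hF := ((tendsto_rpow_mul_gammaKernel (p := -μ + 1) (μ := μ) hμ0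
      (by linarith)).comp hx).const_mul ((2 ^ μ : ℝ) : ℂ)
    have hg : Tendsto (fun z : ℝ => Complex.I * (((z ^ (1 - μ) : ℝ) : ℂ) *
        gammaKernel (-μ) (-μ) (1 / (2 * z)))) (𝓝[>] 0) (𝓝 (Complex.I * 0)) := by
      refine Tendsto.const_mul _ ?_
      have h1 : Tendsto (fun z : ℝ => z ^ (1 - μ) * Real.Gamma (1 - μ)) (𝓝[>] 0) (𝓝 0) := by
        have h2 : Tendsto (fun z : ℝ => z ^ (1 - μ) * Real.Gamma (1 - μ)) (𝓝 0)
            (𝓝 (0 ^ (1 - μ) * Real.Gamma (1 - μ))) :=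
          ((Real.continuous_rpow_const (by linarith)).mul continuous_const).tendsto 0
        rw [Real.zero_rpow (by linarith), zero_mul] at h2
        exact h2.mono_left nhdsWithin_le_nhds
      refine squeeze_zero_norm' ?_ h1
      filter_upwards [self_mem_nhdsWithin] with z hz
      have hz : 0 < z := hz
      rw [norm_mul, Complex.norm_real, Real.norm_of_nonneg (by positivity)]
      refine mul_le_mul_of_nonneg_left ?_ (by positivity)
      have h := norm_gammaKernel_le (p := -μ) (m := -μ) (by linarith) (by linarith) (1 / (2 * z))
      rwa [neg_add_eq_sub] at h
    have he : Tendsto (fun z : ℝ => Complex.exp (Complex.I * z)) (𝓝[>] 0) (𝓝 1) := by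
      have := (hasDerivAt_exp_I_mul 0).continuousAt.tendsto
      simp only [Complex.ofReal_zero, mul_zero, Complex.exp_zero] at this
      exact this.mono_left nhdsWithin_le_nhds
    have h := he.mul (hg.sub hF)
    rw [mul_zero, zero_sub, one_mul] at h
    refine h.congr' ?_
    filter_upwards [self_mem_nhdsWithin] with z hz
    have hz : 0 < z := hz
    have hzc : (z : ℂ) ≠ 0 := by exact_mod_cast hz.ne'
    have hp : ((2 ^ μ : ℝ) : ℂ) * (((1 / (2 * z)) ^ μ : ℝ) : ℂ) = ((z ^ (1 - μ) : ℝ) : ℂ) / z := by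
      rw [← Complex.ofReal_mul, ← Complex.ofReal_div, ← Real.mul_rpow (by norm_num) (by positivity),
        show 2 * (1 / (2 * z)) = z⁻¹ by field_simp, Real.rpow_sub hz, Real.rpow_one,
        Real.inv_rpow hz.le]
      congr 1
      field_simp
    simp only [Function.comp]
    rw [← mul_assoc (((2 ^ μ : ℝ) : ℂ)), hp, hankelSol_first_order hμ0 hμ1 hz, hankelSol]
    field_simp
    ring

/-- Sturm-type comparison of a solution of the perturbed equation with `hankelSol`. -/
lemma comparison_bound {μ κ' N U₀ : ℝ} {u u' : ℝ → ℝ} (hμ0 : 0 ≤ μ) (hμ1 : μ < 1) (hκ' : 0 ≤ κ')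
    (hN : 0 < N) (hu : ∀ t ∈ Ioo 0 Real.pi, HasDerivAt u (u' t) t)
    (hu' : ∀ t ∈ Ioo 0 Real.pi, HasDerivAt u'
      (-(N ^ 2 + μ * (1 - μ) / t ^ 2 + potentialGap (μ * (1 - μ)) κ' t) * u t) t)
    (h0 : Tendsto (fun t => u' t - (1 - μ) / t * u t) (𝓝[>] 0) (𝓝 0))
    (h1 : Tendsto (fun t => u t / t ^ (1 - μ)) (𝓝[>] 0) (𝓝 U₀)) {t : ℝ} (ht : t ∈ Ioo 0 Real.pi) :
    (N * Real.Gamma (1 - μ) ^ 2) ^ 2 * u t ^ 2 ≤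
      Real.Gamma (1 - μ) ^ 2 * (N ^ μ * U₀ * (2 ^ μ * Real.Gamma (2 - 2 * μ))) ^ 2 := by
  have hG : 0 < Real.Gamma (1 - μ) := Real.Gamma_pos_of_pos (by linarith)
  have hκ : 0 ≤ μ * (1 - μ) := mul_nonneg hμ0 (by linarith)
  have hpos : ∀ {s : ℝ}, s ∈ Ioo 0 Real.pi → 0 < N * s := fun hs => mul_pos hN hs.1
  have hlin : ∀ s : ℝ, HasDerivAt (fun s => N * s) N s := fun s => by
    simpa using (hasDerivAt_id s).const_mul N
  have hh : ∀ s ∈ Ioo 0 Real.pi, HasDerivAt (fun s => hankelSol μ (N * s))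
      ((N : ℂ) * hankelSolDeriv μ (N * s)) s := fun s hs => by
    refine ((hasDerivAt_hankelSol hμ0 hμ1 (hpos hs)).scomp s (hlin s)).congr_deriv ?_
    rw [Complex.real_smul]
  have hh' : ∀ s ∈ Ioo 0 Real.pi, HasDerivAt (fun s => (N : ℂ) * hankelSolDeriv μ (N * s))
      (((-(N ^ 2 + μ * (1 - μ) / s ^ 2) : ℝ) : ℂ) * hankelSol μ (N * s)) s := fun s hs => by
    have hs0 : (s : ℂ) ≠ 0 := by exact_mod_cast hs.1.ne'
    have hN0 : (N : ℂ) ≠ 0 := by exact_mod_cast hN.ne'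
    refine (((hasDerivAt_hankelSolDeriv hμ0 hμ1 (hpos hs)).scomp s (hlin s)).const_mul
      (N : ℂ)).congr_deriv ?_
    rw [Complex.real_smul]
    push_cast
    field_simp
  refine sonin_bound (a := fun s => (hankelSol μ (N * s)).re)
    (a' := fun s => ((N : ℂ) * hankelSolDeriv μ (N * s)).re)
    (b := fun s => (hankelSol μ (N * s)).im)
    (b' := fun s => ((N : ℂ) * hankelSolDeriv μ (N * s)).im)
    (q := fun s => N ^ 2 + μ * (1 - μ) / s ^ 2) (by positivity)
    (fun s hs => (hh s hs).re_ofComplex)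
    (fun s hs => by
      have := (hh' s hs).re_ofComplex
      rwa [Complex.re_ofReal_mul] at this)
    (fun s hs => (hh s hs).im_ofComplex)
    (fun s hs => by
      have := (hh' s hs).im_ofComplex
      rwa [Complex.im_ofReal_mul] at this)
    hu hu' (fun s hs => hasDerivAt_potentialGap _ _ hs)
    (fun s hs => potentialGap_nonneg hκ hκ' hs) (fun s hs => potentialGapDeriv_nonneg hκ hκ' hs)
    ?_ ?_ ?_ ?_ ht
  · intro s hs
    rw [← hankelSol_wronskian hμ0 hμ1 (hpos hs)]
    simp only [Complex.re_ofReal_mul, Complex.im_ofReal_mul]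
    ring
  · intro s hs
    have h := mul_nonneg hN.le (hankelSol_modulus_deriv_nonneg hμ0 hμ1 (hpos hs))
    rw [conj_mul_re] at h
    simp only [Complex.re_ofReal_mul, Complex.im_ofReal_mul]
    linarith
  · intro s hs
    have h := normSq_hankelSol_le hμ0 hμ1 (N * s)
    rw [Complex.normSq_apply] at h
    simp only [sq] at h ⊢
    exact h
  · obtain ⟨l, hl, hlt⟩ := tendsto_hankelSol_connection hμ0 hμ1
    have hNt : Tendsto (fun s : ℝ => N * s) (𝓝[>] 0) (𝓝[>] 0) := by
      refine tendsto_nhdsWithin_iff.2 ⟨?_, ?_⟩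
      · have : Tendsto (fun s : ℝ => N * s) (𝓝 0) (𝓝 (N * 0)) :=
          (continuous_const.mul continuous_id).tendsto 0
        rw [mul_zero] at this
        exact this.mono_left nhdsWithin_le_nhds
      · filter_upwards [self_mem_nhdsWithin] with s hs
        exact mul_pos hN hs
    have hA : Tendsto (fun s => hankelSol μ (N * s) * ((u' s - (1 - μ) / s * u s : ℝ) : ℂ))
        (𝓝[>] 0) (𝓝 0) := by
      have h2 := h0.abs.const_mul (Real.Gamma (1 - μ))
      rw [abs_zero, mul_zero] at h2
      refine squeeze_zero_norm (fun s => ?_) h2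
      rw [norm_mul, Complex.norm_real, Real.norm_eq_abs]
      refine mul_le_mul_of_nonneg_right ?_ (abs_nonneg _)
      have h := normSq_hankelSol_le hμ0 hμ1 (N * s)
      rw [Complex.normSq_eq_norm_sq] at h
      exact (pow_le_pow_iff_left₀ (norm_nonneg _) hG.le two_ne_zero).1 h
    have hB := ((hlt.comp hNt).mul
      ((Complex.continuous_ofReal.tendsto U₀).comp h1)).const_mul ((N ^ μ : ℝ) : ℂ)
    have hV := (Complex.continuous_normSq.tendsto _).comp (hA.sub hB)
    have e : Complex.normSq (0 - ((N ^ μ : ℝ) : ℂ) * (l * (U₀ : ℂ))) =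
        (N ^ μ * U₀ * (2 ^ μ * Real.Gamma (2 - 2 * μ))) ^ 2 := by
      rw [zero_sub, Complex.normSq_neg, map_mul, map_mul, Complex.normSq_ofReal,
        Complex.normSq_ofReal, Complex.normSq_eq_norm_sq l, hl]
      ring
    rw [e] at hV
    refine hV.congr' ?_
    filter_upwards [Ioo_mem_nhdsGT Real.pi_pos] with s hs
    have hs0 : (s : ℂ) ≠ 0 := by exact_mod_cast hs.1.ne'
    have hN0 : (N : ℂ) ≠ 0 := by exact_mod_cast hN.ne'
    have hsp : ((s ^ (1 - μ) : ℝ) : ℂ) ≠ 0 := by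
      exact_mod_cast (Real.rpow_pos_of_pos hs.1 _).ne'
    have hNp : ((N ^ μ : ℝ) : ℂ) ≠ 0 := by
      exact_mod_cast (Real.rpow_pos_of_pos hN _).ne'
    have hpow : (((N * s) ^ (1 - μ) : ℝ) : ℂ) = N / ((N ^ μ : ℝ) : ℂ) * ((s ^ (1 - μ) : ℝ) : ℂ) := by
      rw [Real.mul_rpow hN.le hs.1.le, Real.rpow_sub hN, Real.rpow_one]
      push_cast
      ring
    have ev : hankelSol μ (N * s) * ((u' s - (1 - μ) / s * u s : ℝ) : ℂ) -
        ((N ^ μ : ℝ) : ℂ) * ((((N * s) ^ (1 - μ) : ℝ) : ℂ) * (hankelSolDeriv μ (N * s) -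
          (1 - μ) / ((N * s : ℝ) : ℂ) * hankelSol μ (N * s)) * ((u s / s ^ (1 - μ) : ℝ) : ℂ)) =
        hankelSol μ (N * s) * (u' s : ℂ) - (N : ℂ) * hankelSolDeriv μ (N * s) * (u s : ℂ) := by
      rw [hpow, Complex.ofReal_div (u s)]
      generalize ((s ^ (1 - μ) : ℝ) : ℂ) = S at *
      generalize ((N ^ μ : ℝ) : ℂ) = M at *
      push_cast
      field_simp
      ring
    simp only [Function.comp]
    rw [ev, Complex.normSq_apply, Complex.sub_re, Complex.sub_im, Complex.re_mul_ofReal,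
      Complex.re_mul_ofReal, Complex.im_mul_ofReal, Complex.im_mul_ofReal]
    ring

lemma intervalIntegrable_jacobiWeight_mul {α β : ℝ} (hα : -1 < α) (hβ : -1 < β)
    {f : ℝ → ℝ} (hf : Continuous f) :
    IntervalIntegrable (fun x => (1 - x) ^ α * (1 + x) ^ β * f x) volume (-1) 1 := by
  have h1 : IntervalIntegrable (fun x : ℝ => (1 + x) ^ β) volume (-1) 0 := by
    have := (intervalIntegral.intervalIntegrable_rpow' (a := 0) (b := 1) hβ).comp_add_left 1
    simpa using this
  have h2 : IntervalIntegrable (fun x : ℝ => (1 - x) ^ α) volume 0 1 := by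
    have := (intervalIntegral.intervalIntegrable_rpow' (a := 1) (b := 0) hα).comp_sub_left 1
    simpa using this
  refine IntervalIntegrable.trans (b := 0) ?_ ?_
  · refine IntervalIntegrable.mul_continuousOn ?_ hf.continuousOn
    refine h1.continuousOn_mul (ContinuousOn.rpow_const (by fun_prop) fun x hx => Or.inl ?_)
    rw [uIcc_of_le (by norm_num)] at hx
    linarith [hx.2]
  · refine IntervalIntegrable.mul_continuousOn ?_ hf.continuousOn
    refine h2.mul_continuousOn (ContinuousOn.rpow_const (by fun_prop) fun x hx => Or.inl ?_)
    rw [uIcc_of_le (by norm_num)] at hx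
    linarith [hx.1]

/-- The Jacobi differential operator. -/
noncomputable def jacobiOp (α β : ℝ) (f : Polynomial ℝ) : Polynomial ℝ :=
  (1 - Polynomial.X ^ 2) * f.derivative.derivative +
    (Polynomial.C (β - α) - Polynomial.C (α + β + 2) * Polynomial.X) * f.derivative

lemma coeff_jacobiOp (α β : ℝ) (f : Polynomial ℝ) (k : ℕ) :
    (jacobiOp α β f).coeff k = (k + 2) * (k + 1) * f.coeff (k + 2) +
      (β - α) * (k + 1) * f.coeff (k + 1) - k * (k + α + β + 1) * f.coeff k := by
  rw [jacobiOp, sub_mul, sub_mul, one_mul, mul_assoc]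
  simp only [Polynomial.coeff_add, Polynomial.coeff_sub, Polynomial.coeff_C_mul,
    Polynomial.coeff_derivative, Polynomial.coeff_X_pow_mul']
  rcases k with _ | _ | k
  · simp; ring
  · simp [Polynomial.coeff_X_mul, Polynomial.coeff_derivative]; ring
  · simp [Polynomial.coeff_X_mul, Polynomial.coeff_derivative]; ring

lemma integral_jacobiOp_symm {α β : ℝ} (hα : -1 < α) (hβ : -1 < β) (f g : Polynomial ℝ) :
    ∫ x in (-1 : ℝ)..1, (1 - x) ^ α * (1 + x) ^ β *
      ((jacobiOp α β f).eval x * g.eval x - f.eval x * (jacobiOp α β g).eval x) = 0 := by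
  have h := intervalIntegral.integral_eq_sub_of_hasDerivAt_of_le (a := (-1 : ℝ)) (b := 1)
    (f := fun x => (1 - x) ^ (α + 1) * (1 + x) ^ (β + 1) *
      (f.derivative.eval x * g.eval x - f.eval x * g.derivative.eval x))
    (f' := fun x => (1 - x) ^ α * (1 + x) ^ β *
      ((jacobiOp α β f).eval x * g.eval x - f.eval x * (jacobiOp α β g).eval x))
    (by norm_num) ?_ ?_ (intervalIntegrable_jacobiWeight_mul hα hβ (by fun_prop))
  · rw [h]
    simp [Real.zero_rpow (show α + 1 ≠ 0 by linarith), Real.zero_rpow (show β + 1 ≠ 0 by linarith)]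
  · refine Continuous.continuousOn ?_
    refine Continuous.mul (Continuous.mul ?_ ?_) (by fun_prop)
    · exact (Real.continuous_rpow_const (by linarith)).comp (by fun_prop)
    · exact (Real.continuous_rpow_const (by linarith)).comp (by fun_prop)
  · intro x hx
    have hx1 : 0 < 1 - x := by linarith [hx.2]
    have hx2 : 0 < 1 + x := by linarith [hx.1]
    have d1 := ((hasDerivAt_id x).const_sub 1).rpow_const (p := α + 1) (Or.inl hx1.ne')
    have d2 := ((hasDerivAt_id x).const_add 1).rpow_const (p := β + 1) (Or.inl hx2.ne')
    have d3 := ((f.derivative.hasDerivAt x).mul (g.hasDerivAt x)).sub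
      ((f.hasDerivAt x).mul (g.derivative.hasDerivAt x))
    refine ((d1.mul d2).mul d3).congr_deriv ?_
    simp only [id, Pi.mul_apply, Pi.sub_apply, add_sub_cancel_right, Real.rpow_add_one hx1.ne',
      Real.rpow_add_one hx2.ne', jacobiOp]
    simp
    ring

lemma integral_jacobiWeight_mul_eq_zero {α β : ℝ} (hα : -1 < α) (hβ : -1 < β) {n : ℕ}
    {P : Polynomial ℝ} (hP : IsMonicJacobi α β n P) {g : Polynomial ℝ} (hg : g.degree < n) :
    ∫ x in (-1 : ℝ)..1, (1 - x) ^ α * (1 + x) ^ β * (P.eval x * g.eval x) = 0 := by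
  rcases eq_or_ne g 0 with rfl | h0
  · simp
  have hgn : g.natDegree < n := (Polynomial.natDegree_lt_iff_degree_lt h0).2 hg
  have e : ∀ x : ℝ, (1 - x) ^ α * (1 + x) ^ β * (P.eval x * g.eval x) =
      ∑ k ∈ Finset.range n, g.coeff k * ((1 - x) ^ α * (1 + x) ^ β * (P.eval x * x ^ k)) := by
    intro x
    rw [Polynomial.eval_eq_sum_range' hgn, Finset.mul_sum, Finset.mul_sum]
    exact Finset.sum_congr rfl fun k _ => by ring
  simp only [e]
  rw [intervalIntegral.integral_finsetSum fun k _ =>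
    (intervalIntegrable_jacobiWeight_mul hα hβ (by fun_prop)).const_mul _]
  refine Finset.sum_eq_zero fun k hk => ?_
  rw [intervalIntegral.integral_const_mul]
  have := hP.2.2 k (Finset.mem_range.1 hk)
  simp only [mul_assoc] at this ⊢
  rw [this, mul_zero]

lemma eq_zero_of_integral_jacobiWeight_mul_sq {α β : ℝ} (hα : -1 < α) (hβ : -1 < β)
    {Q : Polynomial ℝ}
    (h : ∫ x in (-1 : ℝ)..1, (1 - x) ^ α * (1 + x) ^ β * (Q.eval x * Q.eval x) = 0) : Q = 0 := by
  by_contra h0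
  refine lt_irrefl (0 : ℝ) ?_
  conv_rhs => rw [← h]
  rw [intervalIntegral.integral_pos_iff_support_of_nonneg_ae' ?_
    (intervalIntegrable_jacobiWeight_mul hα hβ (by fun_prop))]
  · refine ⟨by norm_num, ?_⟩
    have hfin : (Q.rootSet ℝ).Finite := Q.rootSet_finite ℝ
    have hsub : Ioo (-1 : ℝ) 1 \ Q.rootSet ℝ ⊆ Function.support
        (fun x => (1 - x) ^ α * (1 + x) ^ β * (Q.eval x * Q.eval x)) ∩ Ioc (-1) 1 := by
      rintro x ⟨hx, hr⟩
      have hx1 : 0 < 1 - x := by linarith [hx.2]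
      have hx2 : 0 < 1 + x := by linarith [hx.1]
      have hQ : Q.eval x ≠ 0 := fun h => hr (by
        rw [Polynomial.mem_rootSet]; exact ⟨h0, by simpa using h⟩)
      refine ⟨?_, Ioo_subset_Ioc_self hx⟩
      rw [Function.mem_support]
      positivity
    refine lt_of_lt_of_le ?_ (measure_mono hsub)
    rw [measure_sdiff_null (hfin.measure_zero volume), Real.volume_Ioo]
    norm_num
  · rw [uIoc_of_le (by norm_num)]
    filter_upwards [ae_restrict_mem measurableSet_Ioc] with x hx
    have hx1 : 0 ≤ 1 - x := by linarith [hx.2]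
    have hx2 : 0 ≤ 1 + x := by linarith [hx.1]
    have := mul_self_nonneg (Q.eval x)
    simp only [Pi.zero_apply]
    positivity

lemma IsMonicJacobi.jacobiOp_eq {α β : ℝ} (hα : -1 < α) (hβ : -1 < β) {n : ℕ}
    {P : Polynomial ℝ} (hP : IsMonicJacobi α β n P) :
    jacobiOp α β P + Polynomial.C (n * (n + α + β + 1)) * P = 0 := by
  set Q := jacobiOp α β P + Polynomial.C (n * (n + α + β + 1)) * P with hQ
  have hPc : ∀ k, n < k → P.coeff k = 0 := fun k hk =>
    Polynomial.coeff_eq_zero_of_natDegree_lt (by rw [hP.2.1]; exact hk)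
  have hQn : Q.degree < n := by
    rw [Polynomial.degree_lt_iff_coeff_zero]
    intro k hk
    rw [hQ, Polynomial.coeff_add, coeff_jacobiOp, Polynomial.coeff_C_mul, hPc (k + 2) (by omega),
      hPc (k + 1) (by omega)]
    rcases hk.eq_or_lt with rfl | hk
    · ring
    · rw [hPc k hk]; ring
  have hLn : (jacobiOp α β Q).degree < n := by
    rw [Polynomial.degree_lt_iff_coeff_zero] at hQn ⊢
    intro k hk
    rw [coeff_jacobiOp, hQn _ (by omega), hQn _ (by omega), hQn _ hk]
    ring
  refine eq_zero_of_integral_jacobiWeight_mul_sq hα hβ ?_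
  have h1 := integral_jacobiOp_symm hα hβ P Q
  have h2 := integral_jacobiWeight_mul_eq_zero hα hβ hP hLn
  have h3 := integral_jacobiWeight_mul_eq_zero hα hβ hP hQn
  have i1 := intervalIntegrable_jacobiWeight_mul hα hβ (f := fun x => (jacobiOp α β P).eval x *
    Q.eval x - P.eval x * (jacobiOp α β Q).eval x) (by fun_prop)
  have i2 := intervalIntegrable_jacobiWeight_mul hα hβ
    (f := fun x => P.eval x * (jacobiOp α β Q).eval x) (by fun_prop)
  have i3 := (intervalIntegrable_jacobiWeight_mul hα hβ
    (f := fun x => P.eval x * Q.eval x) (by fun_prop)).const_mul (n * (n + α + β + 1))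
  have e : ∀ x : ℝ, (1 - x) ^ α * (1 + x) ^ β * (Q.eval x * Q.eval x) =
      (1 - x) ^ α * (1 + x) ^ β * ((jacobiOp α β P).eval x * Q.eval x -
        P.eval x * (jacobiOp α β Q).eval x) +
      (1 - x) ^ α * (1 + x) ^ β * (P.eval x * (jacobiOp α β Q).eval x) +
      n * (n + α + β + 1) * ((1 - x) ^ α * (1 + x) ^ β * (P.eval x * Q.eval x)) := by
    intro x
    have : Q.eval x = (jacobiOp α β P).eval x + n * (n + α + β + 1) * P.eval x := by
      rw [hQ, Polynomial.eval_add, Polynomial.eval_mul, Polynomial.eval_C]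
    linear_combination ((1 - x) ^ α * (1 + x) ^ β * Q.eval x) * this
  simp only [e]
  rw [intervalIntegral.integral_add (i1.add i2) i3, intervalIntegral.integral_add i1 i2,
    intervalIntegral.integral_const_mul, h1, h2, h3]
  ring

lemma IsMonicJacobi.taylor_coeff_succ {α β : ℝ} (hα : -1 < α) (hβ : -1 < β) {n : ℕ}
    {P : Polynomial ℝ} (hP : IsMonicJacobi α β n P) (k : ℕ) :
    2 * (k + 1) * (k + α + 1) * (Polynomial.taylor 1 P).coeff (k + 1) =
      (n - k) * (n + k + α + β + 1) * (Polynomial.taylor 1 P).coeff k := by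
  have h := congrArg (Polynomial.taylor 1) (hP.jacobiOp_eq hα hβ)
  set T := Polynomial.taylor 1 P with hT
  have d1 : Polynomial.taylor 1 P.derivative = T.derivative := by
    rw [hT, Polynomial.taylor_apply, Polynomial.taylor_apply, Polynomial.derivative_comp]
    simp
  have d2 : Polynomial.taylor 1 P.derivative.derivative = T.derivative.derivative := by
    rw [← d1, Polynomial.taylor_apply, Polynomial.taylor_apply, Polynomial.derivative_comp]
    simp
  simp only [jacobiOp, map_add, Polynomial.taylor_mul, map_sub, map_zero, d1, d2,
    Polynomial.taylor_pow, Polynomial.taylor_X, Polynomial.taylor_C, Polynomial.taylor_one,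
    ← hT] at h
  have h' : -(Polynomial.X ^ 2 * T.derivative.derivative) -
      Polynomial.C 2 * (Polynomial.X * T.derivative.derivative) -
      Polynomial.C (2 * α + 2) * T.derivative -
      Polynomial.C (α + β + 2) * (Polynomial.X * T.derivative) +
      Polynomial.C (n * (n + α + β + 1)) * T = 0 := by
    rw [← h]
    simp only [Polynomial.C_add, Polynomial.C_mul, Polynomial.C_1]
    have : (Polynomial.C 2 : Polynomial ℝ) = 2 := rfl
    rw [this]
    ring
  have hk := congrArg (fun p => Polynomial.coeff p k) h'
  simp only [Polynomial.coeff_add, Polynomial.coeff_sub, Polynomial.coeff_C_mul,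
    Polynomial.coeff_neg, Polynomial.coeff_derivative, Polynomial.coeff_X_pow_mul',
    Polynomial.coeff_zero] at hk
  rcases k with _ | _ | k
  · simp at hk ⊢; linear_combination -hk
  · simp [Polynomial.coeff_X_mul, Polynomial.coeff_derivative] at hk ⊢; linear_combination -hk
  · simp [Polynomial.coeff_X_mul, Polynomial.coeff_derivative] at hk ⊢; linear_combination -hk

lemma IsMonicJacobi.eval_one {α β : ℝ} (hα : -1 / 2 ≤ α) (hβ : -1 / 2 ≤ β) {n : ℕ} (hn : 1 ≤ n)
    {P : Polynomial ℝ} (hP : IsMonicJacobi α β n P) :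
    P.eval 1 * Real.Gamma (2 * n + α + β + 1) * Real.Gamma (α + 1) =
      2 ^ n * Real.Gamma (n + α + 1) * Real.Gamma (n + α + β + 1) := by
  have hn' : (1 : ℝ) ≤ n := by exact_mod_cast hn
  set c := (Polynomial.taylor 1 P).coeff with hc
  have key : ∀ m ≤ n, c 0 * n.factorial * Real.Gamma (n + m + α + β + 1) * Real.Gamma (α + 1) =
      c m * 2 ^ m * m.factorial * (n - m).factorial * Real.Gamma (m + α + 1) *
        Real.Gamma (n + α + β + 1) := by
    intro m
    induction m with
    | zero => intro _; simp; ring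
    | succ m ih =>
      intro hm
      have ih := ih (by omega)
      have hr := hP.taylor_coeff_succ (by linarith) (by linarith) m
      have hm0 : (0 : ℝ) ≤ m := by positivity
      have g1 : Real.Gamma (n + (m + 1 : ℕ) + α + β + 1) =
          (n + m + α + β + 1) * Real.Gamma (n + m + α + β + 1) := by
        rw [← Real.Gamma_add_one (by linarith)]
        congr 1; push_cast; ring
      have g2 : Real.Gamma ((m + 1 : ℕ) + α + 1) = (m + α + 1) * Real.Gamma (m + α + 1) := by
        rw [← Real.Gamma_add_one (by linarith)]
        congr 1; push_cast; ring
      have g3 : ((n - m).factorial : ℝ) = (n - m) * (n - (m + 1)).factorial := by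
        obtain ⟨d, rfl⟩ := Nat.exists_eq_add_of_lt hm
        rw [show m + d + 1 - m = d + 1 by omega, show m + d + 1 - (m + 1) = d by omega,
          Nat.factorial_succ]
        push_cast; ring
      rw [g3] at ih
      rw [g1, g2, Nat.factorial_succ, pow_succ]
      push_cast
      linear_combination (n + m + α + β + 1) * ih - 2 ^ m * m.factorial *
        (n - (m + 1)).factorial * Real.Gamma (m + α + 1) * Real.Gamma (n + α + β + 1) * hr
  have h := key n le_rfl
  have hcn : c n = 1 := by
    have h1 : (Polynomial.taylor 1 P).Monic := by
      rw [Polynomial.Monic, Polynomial.leadingCoeff_taylor]; exact hP.1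
    have h2 : (Polynomial.taylor 1 P).natDegree = n := by
      rw [Polynomial.natDegree_taylor, hP.2.1]
    rw [hc, ← h2]; exact h1
  have hc0 : c 0 = P.eval 1 := Polynomial.taylor_coeff_zero 1 P
  rw [hcn, hc0, Nat.sub_self, Nat.factorial_zero, Nat.cast_one, mul_one,
    show (n + n + α + β + 1 : ℝ) = 2 * n + α + β + 1 by ring] at h
  have hf : (n.factorial : ℝ) ≠ 0 := by positivity
  refine mul_left_cancel₀ hf ?_
  linear_combination h

lemma IsMonicJacobi.reflect {α β : ℝ} {n : ℕ} {P : Polynomial ℝ} (hP : IsMonicJacobi α β n P) :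
    IsMonicJacobi β α n (Polynomial.C ((-1) ^ n) * P.comp (-Polynomial.X)) := by
  have hnd : (P.comp (-Polynomial.X)).natDegree = n := by
    rw [Polynomial.natDegree_comp, hP.2.1]; simp
  have hne : ((-1 : ℝ) ^ n) ≠ 0 := by positivity
  refine ⟨?_, ?_, ?_⟩
  · rw [Polynomial.Monic, Polynomial.leadingCoeff_mul, Polynomial.leadingCoeff_C,
      Polynomial.leadingCoeff_comp (by simp), hP.1, hP.2.1]
    simp [← mul_pow]
  · rw [Polynomial.natDegree_C_mul hne, hnd]
  · intro k hk
    have h := hP.2.2 k hk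
    rw [← neg_neg (1 : ℝ), ← intervalIntegral.integral_comp_neg, neg_neg] at h
    have e : ∀ x : ℝ, (1 - x) ^ β * (1 + x) ^ α *
        (Polynomial.C ((-1) ^ n) * P.comp (-Polynomial.X)).eval x * x ^ k =
        (-1) ^ n * (-1) ^ k *
          ((1 - -x) ^ α * (1 + -x) ^ β * Polynomial.eval (-x) P * (-x) ^ k) := by
      intro x
      have hk1 : ((-1 : ℝ) ^ k) * (-1) ^ k = 1 := by rw [← mul_pow]; simp
      rw [neg_pow x k]
      simp only [Polynomial.eval_mul, Polynomial.eval_C, Polynomial.eval_comp, Polynomial.eval_neg,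
        Polynomial.eval_X, sub_neg_eq_add, ← sub_eq_add_neg]
      linear_combination (-((1 - x) ^ β * (1 + x) ^ α * (-1) ^ n * Polynomial.eval (-x) P *
        x ^ k)) * hk1
    simp only [e]
    rw [intervalIntegral.integral_const_mul, h, mul_zero]

/-- `sin(t/2)^p cos(t/2)^r`. -/
noncomputable def halfAngleWeight (p r t : ℝ) : ℝ := Real.sin (t / 2) ^ p * Real.cos (t / 2) ^ r

/-- The logarithmic derivative of `halfAngleWeight`. -/
noncomputable def halfAngleLogDeriv (p r t : ℝ) : ℝ :=
  p * (Real.cos (t / 2) / (2 * Real.sin (t / 2))) - r * (Real.sin (t / 2) / (2 * Real.cos (t / 2)))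

lemma continuous_halfAngleWeight {p r : ℝ} (hp : 0 ≤ p) (hr : 0 ≤ r) :
    Continuous (halfAngleWeight p r) := by
  unfold halfAngleWeight
  exact ((Real.continuous_rpow_const hp).comp (by fun_prop)).mul
    ((Real.continuous_rpow_const hr).comp (by fun_prop))

lemma hasDerivAt_halfAngleWeight (p r : ℝ) {t : ℝ} (ht : t ∈ Ioo 0 Real.pi) :
    HasDerivAt (halfAngleWeight p r) (halfAngleWeight p r t * halfAngleLogDeriv p r t) t := by
  have hs := sin_half_pos ht
  have hc := cos_half_pos ht
  have h := ((hasDerivAt_sin_half t).rpow_const (p := p) (Or.inl hs.ne')).mul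
    ((hasDerivAt_cos_half t).rpow_const (p := r) (Or.inl hc.ne'))
  refine h.congr_deriv ?_
  rw [halfAngleWeight, halfAngleLogDeriv, Real.rpow_sub_one hs.ne', Real.rpow_sub_one hc.ne']
  field_simp
  ring

lemma hasDerivAt_halfAngleLogDeriv (p r : ℝ) {t : ℝ} (ht : t ∈ Ioo 0 Real.pi) :
    HasDerivAt (halfAngleLogDeriv p r)
      (-(p / (4 * Real.sin (t / 2) ^ 2)) - r / (4 * Real.cos (t / 2) ^ 2)) t := by
  have hs := sin_half_pos ht
  have hc := cos_half_pos ht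
  have ds := hasDerivAt_sin_half t
  have dc := hasDerivAt_cos_half t
  have h := ((dc.div (ds.const_mul 2) (by positivity)).const_mul p).sub
    ((ds.div (dc.const_mul 2) (by positivity)).const_mul r)
  refine h.congr_deriv ?_
  have e := Real.sin_sq_add_cos_sq (t / 2)
  field_simp
  linear_combination (-4 * (p * Real.cos (t / 2) ^ 2) - 4 * (r * Real.sin (t / 2) ^ 2)) * e

/-- `sin(t/2)^p cos(t/2)^r P(cos t)`. -/
noncomputable def angularForm (p r : ℝ) (P : Polynomial ℝ) (t : ℝ) : ℝ :=
  halfAngleWeight p r t * P.eval (Real.cos t)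

/-- The derivative of `angularForm`. -/
noncomputable def angularFormDeriv (p r : ℝ) (P : Polynomial ℝ) (t : ℝ) : ℝ :=
  halfAngleWeight p r t * (halfAngleLogDeriv p r t * P.eval (Real.cos t) -
    Real.sin t * P.derivative.eval (Real.cos t))

lemma hasDerivAt_eval_cos (P : Polynomial ℝ) (t : ℝ) :
    HasDerivAt (fun t => P.eval (Real.cos t)) (P.derivative.eval (Real.cos t) * -Real.sin t) t :=
  (P.hasDerivAt (Real.cos t)).comp t (Real.hasDerivAt_cos t)

lemma hasDerivAt_angularForm (p r : ℝ) (P : Polynomial ℝ) {t : ℝ} (ht : t ∈ Ioo 0 Real.pi) :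
    HasDerivAt (angularForm p r P) (angularFormDeriv p r P t) t := by
  refine ((hasDerivAt_halfAngleWeight p r ht).mul (hasDerivAt_eval_cos P t)).congr_deriv ?_
  rw [angularFormDeriv]
  ring

lemma sin_eq_half (t : ℝ) : Real.sin t = 2 * Real.sin (t / 2) * Real.cos (t / 2) := by
  rw [← Real.sin_two_mul]; congr 1; ring

lemma cos_eq_half (t : ℝ) : Real.cos t = Real.cos (t / 2) ^ 2 - Real.sin (t / 2) ^ 2 := by
  rw [← Real.cos_two_mul']; congr 1; ring

lemma IsMonicJacobi.ode {α β : ℝ} (hα : -1 < α) (hβ : -1 < β) {n : ℕ} {P : Polynomial ℝ}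
    (hP : IsMonicJacobi α β n P) (t : ℝ) :
    Real.sin t ^ 2 * P.derivative.derivative.eval (Real.cos t) +
      (β - α - (α + β + 2) * Real.cos t) * P.derivative.eval (Real.cos t) +
      n * (n + α + β + 1) * P.eval (Real.cos t) = 0 := by
  have h := congrArg (Polynomial.eval (Real.cos t)) (hP.jacobiOp_eq hα hβ)
  simp only [jacobiOp, Polynomial.eval_add, Polynomial.eval_mul, Polynomial.eval_sub,
    Polynomial.eval_pow, Polynomial.eval_one, Polynomial.eval_X, Polynomial.eval_C,
    Polynomial.eval_zero] at h
  rw [Real.sin_sq]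
  exact h

lemma IsMonicJacobi.hasDerivAt_angularFormDeriv {α β : ℝ} (hα : -1 < α) (hβ : -1 < β) {n : ℕ}
    {P : Polynomial ℝ} (hP : IsMonicJacobi α β n P) {t : ℝ} (ht : t ∈ Ioo 0 Real.pi) :
    HasDerivAt (angularFormDeriv (α + 1 / 2) (β + 1 / 2) P)
      (-((n + (α + β + 1) / 2) ^ 2 + (1 / 2 - α) * (1 - (1 / 2 - α)) / t ^ 2 +
        potentialGap ((1 / 2 - α) * (1 - (1 / 2 - α))) (1 / 4 - β ^ 2) t) *
          angularForm (α + 1 / 2) (β + 1 / 2) P t) t := by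
  have hs := sin_half_pos ht
  have hc := cos_half_pos ht
  have ht0 := ht.1
  have d := (hasDerivAt_halfAngleWeight (α + 1 / 2) (β + 1 / 2) ht).mul
    (((hasDerivAt_halfAngleLogDeriv (α + 1 / 2) (β + 1 / 2) ht).mul (hasDerivAt_eval_cos P t)).sub
      ((Real.hasDerivAt_sin t).mul (hasDerivAt_eval_cos P.derivative t)))
  refine d.congr_deriv ?_
  have ode := hP.ode hα hβ t
  simp only [Pi.mul_apply, Pi.sub_apply]
  rw [angularForm, potentialGap]
  have e1 : 2 * halfAngleLogDeriv (α + 1 / 2) (β + 1 / 2) t * Real.sin t =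
      α - β + (α + β + 1) * Real.cos t := by
    have e := Real.sin_sq_add_cos_sq (t / 2)
    rw [halfAngleLogDeriv, sin_eq_half t, cos_eq_half t]
    field_simp
    linear_combination (α - β) * e
  have e2 : halfAngleLogDeriv (α + 1 / 2) (β + 1 / 2) t ^ 2 +
      (-((α + 1 / 2) / (4 * Real.sin (t / 2) ^ 2)) - (β + 1 / 2) / (4 * Real.cos (t / 2) ^ 2)) =
      -((1 / 4 - α ^ 2) / (4 * Real.sin (t / 2) ^ 2)) -
        (1 / 4 - β ^ 2) / (4 * Real.cos (t / 2) ^ 2) - (α + β + 1) ^ 2 / 4 := by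
    have e : Real.cos (t / 2) ^ 2 = 1 - Real.sin (t / 2) ^ 2 := by
      rw [← Real.sin_sq_add_cos_sq (t / 2)]; ring
    have h1 : Real.sin (t / 2) ^ 2 / Real.cos (t / 2) ^ 2 = 1 / Real.cos (t / 2) ^ 2 - 1 := by
      field_simp; linarith
    have h2 : Real.cos (t / 2) ^ 2 / Real.sin (t / 2) ^ 2 = 1 / Real.sin (t / 2) ^ 2 - 1 := by
      field_simp; linarith
    have h3 : halfAngleLogDeriv (α + 1 / 2) (β + 1 / 2) t ^ 2 =
        (α + 1 / 2) ^ 2 / 4 * (Real.cos (t / 2) ^ 2 / Real.sin (t / 2) ^ 2) -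
          (α + 1 / 2) * (β + 1 / 2) / 2 +
        (β + 1 / 2) ^ 2 / 4 * (Real.sin (t / 2) ^ 2 / Real.cos (t / 2) ^ 2) := by
      rw [halfAngleLogDeriv]
      field_simp
      ring
    rw [h3, h1, h2]
    ring
  have e3 : (1 / 2 - α) * (1 - (1 / 2 - α)) / t ^ 2 +
      (((1 / 2 - α) * (1 - (1 / 2 - α))) * (1 / (4 * Real.sin (t / 2) ^ 2) - 1 / t ^ 2) +
        (1 / 4 - β ^ 2) * (1 / (4 * Real.cos (t / 2) ^ 2))) =
      (1 / 4 - α ^ 2) / (4 * Real.sin (t / 2) ^ 2) +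
        (1 / 4 - β ^ 2) / (4 * Real.cos (t / 2) ^ 2) := by
    field_simp
    ring
  linear_combination (halfAngleWeight (α + 1 / 2) (β + 1 / 2) t) * (ode -
    P.derivative.eval (Real.cos t) * e1 + P.eval (Real.cos t) * e2 + P.eval (Real.cos t) * e3)

lemma abs_cot_half_sub_inv_le {t : ℝ} (ht : t ∈ Ioo (0 : ℝ) 1) :
    |Real.cos (t / 2) / (2 * Real.sin (t / 2)) - 1 / t| ≤ t := by
  obtain ⟨y, rfl⟩ : ∃ y, t = 2 * y := ⟨t / 2, by ring⟩
  have hy0 : 0 < y := by linarith [ht.1]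
  have hy1 : y < 1 / 2 := by linarith [ht.2]
  rw [mul_div_cancel_left₀ _ (two_ne_zero)]
  have h1 := sin_ge_sub_cube hy0.le
  have h2 := cos_le_quartic hy0.le
  have h3 := Real.one_sub_sq_div_two_le_cos (x := y)
  have h4 := Real.sin_le hy0.le
  have hy2 : y ^ 2 ≤ 1 / 4 := by nlinarith
  have hs : y / 2 ≤ Real.sin y := by nlinarith
  have hs0 : 0 < Real.sin y := by linarith
  have hn0 : 0 ≤ Real.sin y - y * Real.cos y := by
    have := mul_le_mul_of_nonneg_left h2 hy0.le
    nlinarith [pow_pos hy0 3]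
  have hn1 : Real.sin y - y * Real.cos y ≤ y ^ 3 / 2 := by
    have := mul_le_mul_of_nonneg_left h3 hy0.le
    nlinarith
  have e : Real.cos y / (2 * Real.sin y) - 1 / (2 * y) =
      -((Real.sin y - y * Real.cos y) / (2 * (y * Real.sin y))) := by
    field_simp
    ring
  rw [e, abs_neg, abs_of_nonneg (by positivity), div_le_iff₀ (by positivity)]
  nlinarith [mul_le_mul_of_nonneg_left hs (by positivity : 0 ≤ y ^ 2)]

lemma tendsto_angularForm_div {p r : ℝ} (hp : 0 ≤ p) (P : Polynomial ℝ) :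
    Tendsto (fun t => angularForm p r P t / t ^ p) (𝓝[>] 0) (𝓝 ((1 / 2) ^ p * P.eval 1)) := by
  have h1 : Tendsto (fun t => Real.sin (t / 2) / t) (𝓝[>] 0) (𝓝 (1 / 2)) := by
    have h := (hasDerivAt_sin_half 0).tendsto_slope_zero_right
    simp only [zero_add, zero_div, Real.sin_zero, sub_zero, Real.cos_zero, smul_eq_mul] at h
    refine h.congr fun t => ?_
    exact (div_eq_inv_mul _ _).symm
  have h2 := h1.rpow_const (p := p) (Or.inr hp)
  have h3 : Tendsto (fun t => Real.cos (t / 2) ^ r * P.eval (Real.cos t)) (𝓝[>] 0)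
      (𝓝 (1 * P.eval 1)) := by
    have : ContinuousAt (fun t => Real.cos (t / 2) ^ r * P.eval (Real.cos t)) 0 := by
      refine ContinuousAt.mul (ContinuousAt.rpow_const (by fun_prop) (Or.inl (by simp))) ?_
      exact (P.continuous.comp Real.continuous_cos).continuousAt
    have h := this.tendsto
    simp only [zero_div, Real.cos_zero, Real.one_rpow] at h
    exact h.mono_left nhdsWithin_le_nhds
  have h4 := h2.mul h3
  rw [one_mul] at h4
  refine h4.congr' ?_
  filter_upwards [Ioo_mem_nhdsGT Real.pi_pos] with t ht
  rw [angularForm, halfAngleWeight, Real.div_rpow (sin_half_pos ht).le ht.1.le]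
  ring

lemma tendsto_angularFormDeriv_sub {p r : ℝ} (hp : 0 ≤ p) (hr : 0 ≤ r) (P : Polynomial ℝ) :
    Tendsto (fun t => angularFormDeriv p r P t - p / t * angularForm p r P t) (𝓝[>] 0) (𝓝 0) := by
  have h1 : Tendsto (fun t => Real.cos (t / 2) / (2 * Real.sin (t / 2)) - 1 / t) (𝓝[>] 0)
      (𝓝 0) := by
    have h : Tendsto (fun t : ℝ => t) (𝓝[>] 0) (𝓝 0) := tendsto_id.mono_left nhdsWithin_le_nhds
    refine squeeze_zero_norm' ?_ h
    filter_upwards [Ioo_mem_nhdsGT one_pos] with t ht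
    exact abs_cot_half_sub_inv_le ht
  have h2 : Tendsto (fun t => Real.sin (t / 2) / (2 * Real.cos (t / 2))) (𝓝[>] 0) (𝓝 0) := by
    have : ContinuousAt (fun t => Real.sin (t / 2) / (2 * Real.cos (t / 2))) 0 :=
      ContinuousAt.div (by fun_prop) (by fun_prop) (by simp)
    have h := this.tendsto
    simp only [zero_div, Real.sin_zero] at h
    exact h.mono_left nhdsWithin_le_nhds
  have hP : ∀ Q : Polynomial ℝ, Tendsto (fun t => Q.eval (Real.cos t)) (𝓝[>] 0) (𝓝 (Q.eval 1)) := by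
    intro Q
    have h := (Q.continuous.comp Real.continuous_cos).tendsto 0
    simp only [Function.comp, Real.cos_zero] at h
    exact h.mono_left nhdsWithin_le_nhds
  have h3 : Tendsto Real.sin (𝓝[>] 0) (𝓝 0) := by
    have h := Real.continuous_sin.tendsto 0
    rw [Real.sin_zero] at h
    exact h.mono_left nhdsWithin_le_nhds
  have h4 := ((continuous_halfAngleWeight hp hr).tendsto 0).mono_left
    (nhdsWithin_le_nhds (s := Ioi (0 : ℝ)))
  have h := h4.mul ((((h1.const_mul p).sub (h2.const_mul r)).mul (hP P)).sub
    (h3.mul (hP P.derivative)))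
  simp only [mul_zero, sub_zero, zero_mul] at h
  refine h.congr fun t => ?_
  rw [angularFormDeriv, angularForm, halfAngleLogDeriv]
  ring

lemma IsMonicJacobi.eval_one_pos {α β : ℝ} (hα : -1 / 2 ≤ α) (hβ : -1 / 2 ≤ β) {n : ℕ} (hn : 1 ≤ n)
    {P : Polynomial ℝ} (hP : IsMonicJacobi α β n P) : 0 < P.eval 1 := by
  have hn' : (1 : ℝ) ≤ n := by exact_mod_cast hn
  have h := hP.eval_one hα hβ hn
  have g1 : 0 < Real.Gamma (2 * n + α + β + 1) := Real.Gamma_pos_of_pos (by linarith)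
  have g2 : 0 < Real.Gamma (α + 1) := Real.Gamma_pos_of_pos (by linarith)
  have g3 : 0 < Real.Gamma (n + α + 1) := Real.Gamma_pos_of_pos (by linarith)
  have g4 : 0 < Real.Gamma (n + α + β + 1) := Real.Gamma_pos_of_pos (by linarith)
  have h5 : 0 < P.eval 1 * (Real.Gamma (2 * n + α + β + 1) * Real.Gamma (α + 1)) := by
    rw [← mul_assoc, h]; positivity
  exact pos_of_mul_pos_left h5 (by positivity)

lemma IsMonicJacobi.angularForm_bound_of_gt {α β : ℝ} (hα : -1 / 2 < α) (hα' : α ≤ 1 / 2)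
    (hβ : -1 / 2 ≤ β) (hβ' : β ≤ 1 / 2) {n : ℕ} (hn : 1 ≤ n) {P : Polynomial ℝ}
    (hP : IsMonicJacobi α β n P) {t : ℝ} (ht : t ∈ Ioo 0 Real.pi) :
    |angularForm (α + 1 / 2) (β + 1 / 2) P t| *
      (√Real.pi * (n + (α + β + 1) / 2) ^ (α + 1 / 2)) ≤ P.eval 1 * Real.Gamma (α + 1) := by
  have hn' : (1 : ℝ) ≤ n := by exact_mod_cast hn
  have hN : 0 < n + (α + β + 1) / 2 := by linarith
  have hP1 := hP.eval_one_pos hα.le hβ hn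
  have e1 : 1 - (1 / 2 - α) = α + 1 / 2 := by ring
  have h := comparison_bound (μ := 1 / 2 - α) (κ' := 1 / 4 - β ^ 2) (N := n + (α + β + 1) / 2)
    (U₀ := (1 / 2) ^ (α + 1 / 2) * P.eval 1) (by linarith) (by linarith) (by nlinarith) hN
    (fun t ht => hasDerivAt_angularForm (α + 1 / 2) (β + 1 / 2) P ht)
    (fun t ht => hP.hasDerivAt_angularFormDeriv (by linarith) (by linarith) ht)
    (by
      have := tendsto_angularFormDeriv_sub (p := α + 1 / 2) (r := β + 1 / 2) (by linarith)
        (by linarith) P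
      refine this.congr fun t => ?_
      rw [← e1])
    (by rw [e1]; exact tendsto_angularForm_div (by linarith) P) ht
  rw [e1, show 2 - 2 * (1 / 2 - α) = 2 * (α + 1 / 2) by ring] at h
  have hdup := Real.Gamma_mul_Gamma_add_half (α + 1 / 2)
  rw [show α + 1 / 2 + 1 / 2 = α + 1 by ring] at hdup
  set N : ℝ := n + (α + β + 1) / 2
  set G := Real.Gamma (α + 1 / 2)
  set D := Real.Gamma (2 * (α + 1 / 2))
  have hG : 0 < G := Real.Gamma_pos_of_pos (by linarith)
  have hD : 0 < D := Real.Gamma_pos_of_pos (by linarith)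
  have hNm : N ^ (1 / 2 - α) * N ^ (α + 1 / 2) = N := by
    rw [← Real.rpow_add hN, show 1 / 2 - α + (α + 1 / 2) = 1 by ring, Real.rpow_one]
  have h2m : (1 / 2 : ℝ) ^ (α + 1 / 2) * 2 ^ (1 / 2 - α) = 2 ^ (1 - 2 * (α + 1 / 2)) := by
    rw [one_div, Real.inv_rpow (by norm_num), ← Real.rpow_neg (by norm_num),
      ← Real.rpow_add (by norm_num)]
    congr 1; ring
  have hpi : 0 < √Real.pi := Real.sqrt_pos.2 Real.pi_pos
  have hNp : 0 < N ^ (α + 1 / 2) := Real.rpow_pos_of_pos hN _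
  have h' : (N * G ^ 2 * |angularForm (α + 1 / 2) (β + 1 / 2) P t|) ^ 2 ≤
      (G * (N ^ (1 / 2 - α) * ((1 / 2) ^ (α + 1 / 2) * P.eval 1) * (2 ^ (1 / 2 - α) * D))) ^ 2 := by
    rw [mul_pow, sq_abs, mul_pow G]
    exact h
  have h'' := (pow_le_pow_iff_left₀ (by positivity) (by positivity) two_ne_zero).1 h'
  have e3 : G * (N ^ (1 / 2 - α) * ((1 / 2) ^ (α + 1 / 2) * P.eval 1) * (2 ^ (1 / 2 - α) * D)) *
      (√Real.pi * N ^ (α + 1 / 2)) = N * G ^ 2 * (P.eval 1 * Real.Gamma (α + 1)) := by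
    calc _ = (N ^ (1 / 2 - α) * N ^ (α + 1 / 2)) * G * P.eval 1 *
          (D * ((1 / 2) ^ (α + 1 / 2) * 2 ^ (1 / 2 - α)) * √Real.pi) := by ring
      _ = _ := by rw [hNm, h2m, ← hdup]; ring
  have h4 := mul_le_mul_of_nonneg_right h'' (by positivity : 0 ≤ √Real.pi * N ^ (α + 1 / 2))
  rw [e3, mul_assoc] at h4
  exact le_of_mul_le_mul_left h4 (by positivity)

lemma IsMonicJacobi.abs_eval_cos_le {n : ℕ} (hn : 1 ≤ n) {P : Polynomial ℝ}
    (hP : IsMonicJacobi (-1 / 2) (-1 / 2) n P) (t : ℝ) : |P.eval (Real.cos t)| ≤ P.eval 1 := by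
  have hP1 := hP.eval_one_pos le_rfl le_rfl hn
  have hn' : (0 : ℝ) < n := by exact_mod_cast hn
  have hd : ∀ t, HasDerivAt (fun t => (n : ℝ) ^ 2 * P.eval (Real.cos t) ^ 2 +
      (Real.sin t * P.derivative.eval (Real.cos t)) ^ 2) 0 t := by
    intro t
    have ode := hP.ode (by norm_num) (by norm_num) t
    refine ((((hasDerivAt_eval_cos P t).pow 2).const_mul ((n : ℝ) ^ 2)).add
      (((Real.hasDerivAt_sin t).mul (hasDerivAt_eval_cos P.derivative t)).pow 2)).congr_deriv ?_
    simp only [Pi.mul_apply]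
    push_cast
    linear_combination (-2 * Real.sin t * P.derivative.eval (Real.cos t)) * ode
  have h := is_const_of_deriv_eq_zero (fun t => (hd t).differentiableAt) (fun t => (hd t).deriv) t 0
  simp only [Real.cos_zero, Real.sin_zero, zero_mul] at h
  refine abs_le_of_sq_le_sq ?_ hP1.le
  nlinarith [sq_nonneg (Real.sin t * P.derivative.eval (Real.cos t)), pow_pos hn' 2]

lemma IsMonicJacobi.angularForm_bound {α β : ℝ} (hα : -1 / 2 ≤ α) (hα' : α ≤ 1 / 2)
    (hβ : -1 / 2 ≤ β) (hβα : β ≤ α) {n : ℕ} (hn : 1 ≤ n) {P : Polynomial ℝ}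
    (hP : IsMonicJacobi α β n P) {t : ℝ} (ht : t ∈ Ioo 0 Real.pi) :
    |angularForm (α + 1 / 2) (β + 1 / 2) P t| *
      (√Real.pi * (n + (α + β + 1) / 2) ^ (α + 1 / 2)) ≤ P.eval 1 * Real.Gamma (α + 1) := by
  rcases hα.lt_or_eq with h | h
  · exact hP.angularForm_bound_of_gt h hα' hβ (by linarith) hn ht
  · obtain rfl : β = -1 / 2 := by linarith
    subst h
    have e := hP.abs_eval_cos_le hn t
    have e1 : (-1 / 2 + 1 / 2 : ℝ) = 0 := by norm_num
    have e2 : (-1 / 2 + 1 : ℝ) = 1 / 2 := by norm_num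
    rw [angularForm, halfAngleWeight, e1, e2, Real.rpow_zero, Real.rpow_zero, Real.rpow_zero,
      Real.Gamma_one_half_eq, one_mul, one_mul, mul_one]
    exact mul_le_mul_of_nonneg_right e (Real.sqrt_nonneg _)

lemma jacobiWeight_sqrt_cos {α β t : ℝ} (ht : t ∈ Ioo 0 Real.pi) :
    (1 - Real.cos t) ^ (α / 2 + 1 / 4) * (1 + Real.cos t) ^ (β / 2 + 1 / 4) =
      2 ^ ((α + β + 1) / 2) * halfAngleWeight (α + 1 / 2) (β + 1 / 2) t := by
  have hs := sin_half_pos ht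
  have hc := cos_half_pos ht
  have e := Real.sin_sq_add_cos_sq (t / 2)
  have h1 : 1 - Real.cos t = 2 * Real.sin (t / 2) ^ (2 : ℝ) := by
    rw [cos_eq_half, Real.rpow_two]; linarith
  have h2 : 1 + Real.cos t = 2 * Real.cos (t / 2) ^ (2 : ℝ) := by
    rw [cos_eq_half, Real.rpow_two]; linarith
  have h3 : (2 : ℝ) ^ ((α + β + 1) / 2) = 2 ^ (α / 2 + 1 / 4) * 2 ^ (β / 2 + 1 / 4) := by
    rw [← Real.rpow_add two_pos]
    congr 1
    ring
  rw [h1, h2, h3, Real.mul_rpow (by norm_num) (by positivity), Real.mul_rpow (by norm_num)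
    (by positivity), ← Real.rpow_mul hs.le, ← Real.rpow_mul hc.le, halfAngleWeight,
    show 2 * (α / 2 + 1 / 4) = α + 1 / 2 by ring,
    show 2 * (β / 2 + 1 / 4) = β + 1 / 2 by ring]
  ring

lemma IsMonicJacobi.bernstein_bound_of_le {α β : ℝ} (hα : -1 / 2 ≤ α) (hα' : α ≤ 1 / 2)
    (hβ : -1 / 2 ≤ β) (hβα : β ≤ α) {n : ℕ} (hn : 1 ≤ n) {P : Polynomial ℝ}
    (hP : IsMonicJacobi α β n P) {x : ℝ} (hx : x ∈ Icc (-1 : ℝ) 1) :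
    (1 - x) ^ (α / 2 + 1 / 4) * (1 + x) ^ (β / 2 + 1 / 4) * |P.eval x| ≤
      2 ^ ((n : ℝ) + (α + β + 1) / 2) * Real.Gamma (n + α + 1) * Real.Gamma (n + α + β + 1) /
        (√Real.pi * (n + (α + β + 1) / 2) ^ (α + 1 / 2) * Real.Gamma (2 * n + α + β + 1)) := by
  have hn' : (1 : ℝ) ≤ n := by exact_mod_cast hn
  have hcont : Continuous fun x : ℝ =>
      (1 - x) ^ (α / 2 + 1 / 4) * (1 + x) ^ (β / 2 + 1 / 4) * |P.eval x| := by
    refine Continuous.mul (Continuous.mul ?_ ?_) (by fun_prop)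
    · exact (Real.continuous_rpow_const (by linarith)).comp (by fun_prop)
    · exact (Real.continuous_rpow_const (by linarith)).comp (by fun_prop)
  have hcl := isClosed_le hcont (continuous_const (y :=
    2 ^ ((n : ℝ) + (α + β + 1) / 2) * Real.Gamma (n + α + 1) * Real.Gamma (n + α + β + 1) /
        (√Real.pi * (n + (α + β + 1) / 2) ^ (α + 1 / 2) * Real.Gamma (2 * n + α + β + 1))))
  refine hcl.closure_subset_iff.2 ?_ (closure_Ioo (show (-1 : ℝ) ≠ 1 by norm_num) ▸ hx)
  intro y hy
  have ht : Real.arccos y ∈ Ioo 0 Real.pi :=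
    ⟨Real.arccos_pos.2 hy.2, lt_of_le_of_ne (Real.arccos_le_pi y) fun h =>
      absurd (Real.arccos_eq_pi.1 h) (not_le.2 hy.1)⟩
  have h := hP.angularForm_bound hα hα' hβ hβα hn ht
  have hev := hP.eval_one hα hβ hn
  have hw := jacobiWeight_sqrt_cos (α := α) (β := β) ht
  have hw0 : 0 ≤ halfAngleWeight (α + 1 / 2) (β + 1 / 2) (Real.arccos y) := by
    have := sin_half_pos ht
    have := cos_half_pos ht
    rw [halfAngleWeight]; positivity
  rw [angularForm, abs_mul, abs_of_nonneg hw0] at h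
  rw [Real.cos_arccos hy.1.le hy.2.le] at h hw
  have g1 : 0 < Real.Gamma (2 * n + α + β + 1) := Real.Gamma_pos_of_pos (by linarith)
  have hN : 0 < n + (α + β + 1) / 2 := by linarith
  have hpi : 0 < √Real.pi := Real.sqrt_pos.2 Real.pi_pos
  have hNp : 0 < ((n : ℝ) + (α + β + 1) / 2) ^ (α + 1 / 2) := Real.rpow_pos_of_pos hN _
  rw [mem_ofPred_eq, hw, le_div_iff₀ (by positivity), Real.rpow_add two_pos, Real.rpow_natCast]
  have h2 := mul_le_mul_of_nonneg_left h
    (by positivity : 0 ≤ (2 : ℝ) ^ ((α + β + 1) / 2) * Real.Gamma (2 * n + α + β + 1))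
  linear_combination h2 + (2 : ℝ) ^ ((α + β + 1) / 2) * hev

end

theorem monic_jacobi_bernstein_bound
    (α β : ℝ) (hα : α ∈ Set.Icc (-(1 : ℝ) / 2) (1 / 2))
    (hβ : β ∈ Set.Icc (-(1 : ℝ) / 2) (1 / 2))
    (n : ℕ) (hn : 1 ≤ n) (P : Polynomial ℝ) (hP : IsMonicJacobi α β n P) :
    ∀ x ∈ Set.Icc (-1 : ℝ) 1,
      (1 - x) ^ (α / 2 + 1 / 4) * (1 + x) ^ (β / 2 + 1 / 4) * |P.eval x| ≤
        (2 : ℝ) ^ ((n : ℝ) + (α + β + 1) / 2) *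
            Real.Gamma ((n : ℝ) + max α β + 1) * Real.Gamma ((n : ℝ) + α + β + 1) /
          (Real.sqrt Real.pi * ((n : ℝ) + (α + β + 1) / 2) ^ (max α β + 1 / 2) *
            Real.Gamma (2 * (n : ℝ) + α + β + 1)) := by
  intro x hx
  obtain ⟨hα1, hα2⟩ := hα
  obtain ⟨hβ1, hβ2⟩ := hβ
  rcases le_total β α with h | h
  · rw [max_eq_left h]
    exact hP.bernstein_bound_of_le (by linarith) hα2 (by linarith) h hn hx
  · rw [max_eq_right h]
    have hx' : -x ∈ Set.Icc (-1 : ℝ) 1 := ⟨by linarith [hx.2], by linarith [hx.1]⟩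
    have hb := hP.reflect.bernstein_bound_of_le (by linarith) hβ2 (by linarith) h hn hx'
    have e : |(Polynomial.C ((-1) ^ n) * P.comp (-Polynomial.X)).eval (-x)| = |P.eval x| := by
      simp [Polynomial.eval_comp, abs_mul]
    rw [e, sub_neg_eq_add, ← sub_eq_add_neg, add_comm β α, mul_comm ((1 + x) ^ _),
      add_right_comm (n : ℝ) β α, add_right_comm (2 * (n : ℝ)) β α] at hb
    exact hb
end

section
/- Define c_0(α,β) := α⁴/4 + (3β+6)α³/8 + (β+2)²α²/8 + (β²−1)(β+2)α/8 + β⁴/8 + β³/2 + 3β²/8 − β/4 − 1/4. If −1/2 ≤ β ≤ α ≤ 1/2, then c_0(α,β) ≤ 0, with equality if and only if |α| = |β| = 1/2. -/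
/-- In the barycentric coordinates `u, v, w` of a point of the triangle `-1/2 ≤ β ≤ α ≤ 1/2`,
the polynomial `-c₀` has only nonnegative coefficients. -/
lemma c0_barycentric (u v w α β : ℝ) (hα : α = (u + v - w) / 2) (hβ : β = (u - v - w) / 2)
    (h : u + v + w = 1) :
    α ^ 4 / 4 + (3 * β + 6) * α ^ 3 / 8 + (β + 2) ^ 2 * α ^ 2 / 8 +
      (β ^ 2 - 1) * (β + 2) * α / 8 + β ^ 4 / 8 + β ^ 3 / 2 + 3 * β ^ 2 / 8 -
      β / 4 - 1 / 4 =
    -(v * w ^ 3 / 8 + 9 / 16 * (v ^ 2 * w ^ 2) + 11 / 16 * (v ^ 3 * w) + u * w ^ 3 / 4 +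
      15 / 8 * (u * v * w ^ 2) + 27 / 8 * (u * v ^ 2 * w) + 5 / 16 * (u * v ^ 3) +
      3 / 2 * (u ^ 2 * w ^ 2) + 41 / 8 * (u ^ 2 * v * w) + 17 / 16 * (u ^ 2 * v ^ 2) +
      9 / 4 * (u ^ 3 * w) + 7 / 8 * (u ^ 3 * v)) := by
  obtain rfl : w = 1 - u - v := by linarith
  subst hα hβ
  ring

theorem c0_nonpos (α β : ℝ) (h1 : -(1 : ℝ) / 2 ≤ β) (h2 : β ≤ α) (h3 : α ≤ 1 / 2)
    (c0 : ℝ)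
    (hc0 : c0 = α ^ 4 / 4 + (3 * β + 6) * α ^ 3 / 8 + (β + 2) ^ 2 * α ^ 2 / 8 +
      (β ^ 2 - 1) * (β + 2) * α / 8 + β ^ 4 / 8 + β ^ 3 / 2 + 3 * β ^ 2 / 8 -
      β / 4 - 1 / 4) :
    c0 ≤ 0 ∧ (c0 = 0 ↔ |α| = 1 / 2 ∧ |β| = 1 / 2) := by
  obtain ⟨u, hu⟩ : ∃ u, u = β + 1 / 2 := ⟨_, rfl⟩
  obtain ⟨v, hv⟩ : ∃ v, v = α - β := ⟨_, rfl⟩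
  obtain ⟨w, hw⟩ : ∃ w, w = 1 / 2 - α := ⟨_, rfl⟩
  have hu0 : 0 ≤ u := by linarith
  have hv0 : 0 ≤ v := by linarith
  have hw0 : 0 ≤ w := by linarith
  have key := hc0.trans (c0_barycentric u v w α β (by linarith) (by linarith) (by linarith))
  have e1 : 0 ≤ v * w ^ 3 := by positivity
  have e2 : 0 ≤ v ^ 2 * w ^ 2 := by positivity
  have e3 : 0 ≤ v ^ 3 * w := by positivity
  have e4 : 0 ≤ u * w ^ 3 := by positivity
  have e5 : 0 ≤ u * v * w ^ 2 := by positivity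
  have e6 : 0 ≤ u * v ^ 2 * w := by positivity
  have e7 : 0 ≤ u * v ^ 3 := by positivity
  have e8 : 0 ≤ u ^ 2 * w ^ 2 := by positivity
  have e9 : 0 ≤ u ^ 2 * v * w := by positivity
  have e10 : 0 ≤ u ^ 2 * v ^ 2 := by positivity
  have e11 : 0 ≤ u ^ 3 * w := by positivity
  have e12 : 0 ≤ u ^ 3 * v := by positivity
  refine ⟨by linarith, fun h => ?_, fun ⟨hα, hβ⟩ => ?_⟩
  · have huw : u ^ 2 * w ^ 2 = 0 := by linarith
    have huv : u ^ 2 * v ^ 2 = 0 := by linarith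
    have hvw : v ^ 2 * w ^ 2 = 0 := by linarith
    simp only [mul_eq_zero, ne_eq, OfNat.ofNat_ne_zero, not_false_eq_true, pow_eq_zero_iff]
      at huw huv hvw
    rw [abs_eq (by norm_num), abs_eq (by norm_num)]
    grind
  · rw [abs_eq (by norm_num)] at hα hβ
    rcases hα with rfl | rfl <;> rcases hβ with rfl | rfl <;> norm_num at * <;> linarith
end

section
/- Define c_1(α,β) := 3α³/4 + (4β+8)α²/8 + (β²−1)α/4 + β³/2 + β² − β/4 − 1/2. If −1/2 ≤ β ≤ α ≤ 1/2, then c_1(α,β) ≤ 0, with equality if and only if |α| = |β| = 1/2. -/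
theorem c1_nonpos (α β : ℝ) (h1 : -(1 : ℝ) / 2 ≤ β) (h2 : β ≤ α) (h3 : α ≤ 1 / 2)
    (c1 : ℝ)
    (hc1 : c1 = 3 * α ^ 3 / 4 + (4 * β + 8) * α ^ 2 / 8 + (β ^ 2 - 1) * α / 4 +
      β ^ 3 / 2 + β ^ 2 - β / 4 - 1 / 2) :
    c1 ≤ 0 ∧ (c1 = 0 ↔ |α| = 1 / 2 ∧ |β| = 1 / 2) := by
  have hsplit : c1 = -((1 / 4 - α ^ 2) * (1 + 3 * α / 4 + β / 2) +
      (1 / 4 - β ^ 2) * (1 + α / 4 + β / 2)) := by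
    rw [hc1]; ring
  have hα : 0 ≤ 1 / 4 - α ^ 2 := by nlinarith
  have hβ : 0 ≤ 1 / 4 - β ^ 2 := by nlinarith
  have hu : 0 < 1 + 3 * α / 4 + β / 2 := by linarith
  have hv : 0 < 1 + α / 4 + β / 2 := by linarith
  have hαu := mul_nonneg hα hu.le
  have hβv := mul_nonneg hβ hv.le
  have habs (x : ℝ) : |x| = 1 / 2 ↔ 1 / 4 - x ^ 2 = 0 := by
    rw [← abs_of_pos (one_half_pos (α := ℝ)), ← sq_eq_sq_iff_abs_eq_abs, sub_eq_zero, eq_comm]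
    norm_num
  refine ⟨by linarith, ?_⟩
  rw [hsplit, neg_eq_zero, add_eq_zero_iff_of_nonneg hαu hβv, mul_eq_zero_iff_right hu.ne',
    mul_eq_zero_iff_right hv.ne', habs, habs]
end

section
/- Let −1/2 ≤ β ≤ α ≤ 1/2 and define, for x > 0, f(x) := (x+α+1)(x+α+β+1) · (x+(α+β+1)/2)^{α−1/2} / ( (x+(α+β)/2+1) · (x+(α+β+1)/2+1)^{α+1/2} ). Then f(x) ≥ 1 for every x > 0. -/
/-- Weighted AM-GM on each of the intervals `[y, y + 1/2]` and `[y + 1/2, y + 1]`. -/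
lemma rpow_mul_rpow_le_mul_add_half {y t : ℝ} (hy : 0 < y) (ht0 : 0 ≤ t) (ht1 : t ≤ 1) :
    (y + 1 / 2) * (y ^ (1 - t) * (y + 1) ^ t) ≤ (y + (1 + t) / 2) * (y + t / 2) := by
  have hleft := Real.geom_mean_le_arith_mean2_weighted (sub_nonneg.2 ht1) ht0 hy.le
    (show 0 ≤ y + 1 / 2 by positivity) (by ring)
  have hright := Real.geom_mean_le_arith_mean2_weighted (sub_nonneg.2 ht1) ht0
    (show 0 ≤ y + 1 / 2 by positivity) (show 0 ≤ y + 1 by positivity) (by ring)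
  have hmid : (y + 1 / 2) ^ (1 - t) * (y + 1 / 2) ^ t = y + 1 / 2 := by
    rw [← Real.rpow_add (by positivity), sub_add_cancel, Real.rpow_one]
  calc (y + 1 / 2) * (y ^ (1 - t) * (y + 1) ^ t)
      = ((y + 1 / 2) ^ (1 - t) * (y + 1) ^ t) * (y ^ (1 - t) * (y + 1 / 2) ^ t) := by
        linear_combination -(y ^ (1 - t) * (y + 1) ^ t) * hmid
    _ ≤ ((1 - t) * (y + 1 / 2) + t * (y + 1)) * ((1 - t) * y + t * (y + 1 / 2)) := by
        gcongr
    _ = (y + (1 + t) / 2) * (y + t / 2) := by ring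

theorem ratio_function_ge_one (α β : ℝ)
    (h1 : -(1 : ℝ) / 2 ≤ β) (h2 : β ≤ α) (h3 : α ≤ 1 / 2) :
    ∀ x : ℝ, 0 < x →
      1 ≤ (x + α + 1) * (x + α + β + 1) * (x + (α + β + 1) / 2) ^ (α - 1 / 2) /
        ((x + (α + β) / 2 + 1) * (x + (α + β + 1) / 2 + 1) ^ (α + 1 / 2)) := by
  intro x hx
  obtain ⟨y, hxy⟩ : ∃ y, y = x + (α + β + 1) / 2 := ⟨_, rfl⟩
  have hy : 0 < y := by linarith
  have key := rpow_mul_rpow_le_mul_add_half (t := α + 1 / 2) hy (by linarith) (by linarith)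
  have hprod : (y + (1 + (α + 1 / 2)) / 2) * (y + (α + 1 / 2) / 2) ≤
      (x + α + 1) * (x + α + β + 1) := by
    subst hxy
    nlinarith [mul_nonneg (show 0 ≤ 1 / 2 - β by linarith) (show 0 ≤ 1 / 2 + β by linarith)]
  have hcancel : y ^ (1 - (α + 1 / 2)) * y ^ (α - 1 / 2) = 1 := by
    rw [← Real.rpow_add hy, show 1 - (α + 1 / 2) + (α - 1 / 2) = 0 by ring, Real.rpow_zero]
  rw [show x + (α + β) / 2 + 1 = y + 1 / 2 by rw [hxy]; ring, ← hxy, one_le_div (by positivity)]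
  calc (y + 1 / 2) * (y + 1) ^ (α + 1 / 2)
      = (y + 1 / 2) * (y ^ (1 - (α + 1 / 2)) * (y + 1) ^ (α + 1 / 2)) * y ^ (α - 1 / 2) := by
        linear_combination -((y + 1 / 2) * (y + 1) ^ (α + 1 / 2)) * hcancel
    _ ≤ (x + α + 1) * (x + α + β + 1) * y ^ (α - 1 / 2) := by
        exact mul_le_mul_of_nonneg_right (key.trans hprod) (by positivity)
end
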